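/- Suppose r = [m, 2] (i.e., k = 2 and m_2 = 2) with m ≥ 2. Then there do not exist distinct rational numbers s, s′ ∈ I_1(r;n) ∪ I_2(r;n) such that u_s is conjugate in Heck(r;n) to u_{s′} or to u_{s′}^{−1}. -/

import Mathlib

/- Formalization of statements from "Homotopically equivalent simple loops on
2-bridge spheres in Heckoid orbifolds for 2-bridge links (II)" by Lee-Sakuma.

We work in the free group `F` on two generators `a = gen 0`, `b = gen 1`.
For a rational `s` (in lowest terms `q/p`, with `0 ≤ s ≤ 1`), `uWord s` is the
word `u_s = a b^{ε₁} a^{ε₂} ⋯ b^{ε_{2p-1}}` with `ε_i = (-1)^⌊i·s⌋`.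
`CS s` is (a linear representative of) the cyclic sequence of lengths of
maximal constant-sign runs of exponents of `u_s`; since `u_s` begins with a
positive letter and (for `0 < s ≤ 1`) ends with a negative letter, the linear
run-length sequence represents the cyclic one.  `CyclicContains L T` says the
cyclic sequence represented by `L` contains `T` as a block of consecutive
terms.  `cfQ [m₁,…,m_k]` is the continued fraction `1/(m₁+1/(m₂+⋯+1/m_k))`.
`memI1 M n s` / `memI2 M n s` express `s ∈ I₁(r;n)` / `s ∈ I₂(r;n)` where
`r = cfQ M`, and `memI1hat` / `memI2hat` express `s ∈ I₁(r)` / `s ∈ I₂(r)`.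
The Heckoid group `Heck(r;n) = ⟨a,b | u_r^n⟩` is the quotient of `F` by the
normal closure `heckN r n` of `u_r^n`, with quotient map `heckQ r n`. -/

namespace Heckoid

abbrev F : Type := FreeGroup (Fin 2)

/-- The generators: `gen 0 = a`, `gen 1 = b` (and `gen i` depends on parity). -/
def gen (i : ℕ) : F := FreeGroup.of ⟨i % 2, Nat.mod_lt _ (by norm_num)⟩

/-- The word `u_s = a b^{ε₁} a^{ε₂} b^{ε₃} ⋯ a^{ε_{2p-2}} b^{ε_{2p-1}}`,
where `s = q/p` in lowest terms and `ε_i = (-1)^⌊iq/p⌋`. -/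
def uWord (s : ℚ) : F :=
  ((List.range (2 * s.den)).map
    (fun i => gen i ^ ((-1 : ℤ) ^ (⌊(i : ℚ) * s⌋.toNat)))).prod

/-- The sequence of exponent signs `ε₀, ε₁, …, ε_{2p-1}` of `u_s`. -/
def signList (s : ℚ) : List ℤ :=
  (List.range (2 * s.den)).map (fun i => (-1 : ℤ) ^ (⌊(i : ℚ) * s⌋.toNat))

/-- Lengths of the maximal runs of equal consecutive entries. -/
def runLengths {α : Type} [BEq α] (l : List α) : List ℕ :=
  (l.splitBy (· == ·)).map List.length

/-- `CS s = CS(u_s)`: the cyclic sequence of lengths of maximal constant-sign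
runs of `u_s`, represented by a list. -/
def CS (s : ℚ) : List ℕ := runLengths (signList s)

/-- The cyclic sequence represented by `L` contains `T` as a block of
consecutive terms. -/
def CyclicContains (L T : List ℕ) : Prop := ∃ k, T <+: L.rotate k

/-- The continued fraction `[m₁, m₂, …, m_k] = 1/(m₁+1/(m₂+⋯+1/m_k))`. -/
def cfQ : List ℕ → ℚ
  | [] => 0
  | a :: l => 1 / ((a : ℚ) + cfQ l)

/-- `d⟨T, T'⟩`: `d` consecutive repetitions of the concatenation of `T` and `T'`. -/
def rep2 (d : ℕ) (T T' : List ℕ) : List ℕ := (List.replicate d (T ++ T')).flatten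

/-- `s ∈ I₁(r;n)` where `r = cfQ M`:  `[0, [m₁,…,m_{k-1},m_k-1,2]]` for `k` even,
`[0, [m₁,…,m_k,2n-2])` for `k` odd. -/
def memI1 (M : List ℕ) (n : ℕ) (s : ℚ) : Prop :=
  if Even M.length then 0 ≤ s ∧ s ≤ cfQ (M.dropLast ++ [M.getLast! - 1, 2])
  else 0 ≤ s ∧ s < cfQ (M ++ [2 * n - 2])

/-- `s ∈ I₂(r;n)` where `r = cfQ M`: `([m₁,…,m_k,2n-2], 1]` for `k` even,
`[[m₁,…,m_{k-1},m_k-1,2], 1]` for `k` odd. -/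
def memI2 (M : List ℕ) (n : ℕ) (s : ℚ) : Prop :=
  if Even M.length then cfQ (M ++ [2 * n - 2]) < s ∧ s ≤ 1
  else cfQ (M.dropLast ++ [M.getLast! - 1, 2]) ≤ s ∧ s ≤ 1

/-- `s ∈ I₁(r)` where `r = cfQ M`. -/
def memI1hat (M : List ℕ) (s : ℚ) : Prop :=
  if Even M.length then 0 ≤ s ∧ s ≤ cfQ (M.dropLast ++ [M.getLast! - 1])
  else 0 ≤ s ∧ s ≤ cfQ M.dropLast

/-- `s ∈ I₂(r)` where `r = cfQ M`. -/
def memI2hat (M : List ℕ) (s : ℚ) : Prop :=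
  if Even M.length then cfQ M.dropLast ≤ s ∧ s ≤ 1
  else cfQ (M.dropLast ++ [M.getLast! - 1]) ≤ s ∧ s ≤ 1

/-- The normal closure of `u_r^n`, so that `Heck(r;n) = F ⧸ heckN r n`. -/
abbrev heckN (r : ℚ) (n : ℕ) : Subgroup F := Subgroup.normalClosure {uWord r ^ n}

/-- The quotient map `F → Heck(r;n) = ⟨a, b | u_r^n⟩`. -/
def heckQ (r : ℚ) (n : ℕ) : F →* F ⧸ heckN r n := QuotientGroup.mk' (heckN r n)

section Sturmian

variable {G : Type*} [Group G]

/-- The Sturmian-type word with `u` letters `α` and `v` letters `β`. -/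
def sturm (u v : ℕ) (α β : G) : G :=
  ((List.range u).map fun i => β ^ (i * v / u) * α * (β ^ (i * v / u))⁻¹).prod * β ^ v

/-- Differences of consecutive values of `j ↦ ⌈j u / v⌉`. -/
def ceilDiffs (u v : ℕ) : List ℕ :=
  (List.range v).map fun j => ((j + 1) * u + (v - 1)) / v - (j * u + (v - 1)) / v

/-- Differences of consecutive values of `i ↦ ⌊i v / u⌋`. -/
def floorDiffs (u v : ℕ) : List ℕ :=
  (List.range u).map fun i => (i + 1) * v / u - i * v / u

@[simp] lemma length_ceilDiffs (u v : ℕ) : (ceilDiffs u v).length = v := by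
  simp [ceilDiffs]

@[simp] lemma length_floorDiffs (u v : ℕ) : (floorDiffs u v).length = u := by
  simp [floorDiffs]

lemma sum_map_range_sub (f : ℕ → ℕ) (hf : Monotone f) (N : ℕ) :
    ((List.range N).map fun j => f (j + 1) - f j).sum = f N - f 0 := by
  induction N with
  | zero => simp
  | succ N ih =>
    rw [List.range_succ, List.map_append, List.sum_append, ih]
    have h1 := hf (Nat.zero_le N)
    have h2 := hf (Nat.le_succ N)
    simp only [List.map_cons, List.map_nil, List.sum_cons, List.sum_nil, Nat.succ_eq_add_one] at *
    omega

lemma ceil_mono (u v : ℕ) : Monotone fun j => (j * u + (v - 1)) / v := fun _ _ h =>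
  Nat.div_le_div_right (Nat.add_le_add_right (Nat.mul_le_mul_right _ h) _)

lemma floor_mono (u v : ℕ) : Monotone fun i => i * v / u := fun _ _ h =>
  Nat.div_le_div_right (Nat.mul_le_mul_right _ h)

lemma ceil_top (u : ℕ) {v : ℕ} (hv : 0 < v) : (v * u + (v - 1)) / v = u := by
  rw [Nat.mul_add_div hv, Nat.div_eq_of_lt (by omega), add_zero]

lemma ceil_zero (u v : ℕ) : (0 * u + (v - 1)) / v = 0 := by
  rcases Nat.eq_zero_or_pos v with rfl | hv
  · simp
  · rw [zero_mul, zero_add]; exact Nat.div_eq_of_lt (by omega)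

lemma sum_ceilDiffs (u : ℕ) {v : ℕ} (hv : 0 < v) : (ceilDiffs u v).sum = u := by
  have := sum_map_range_sub _ (ceil_mono u v) v
  simp only [ceil_top u hv, ceil_zero] at this
  simpa [ceilDiffs] using this

lemma sum_floorDiffs {u : ℕ} (v : ℕ) (hu : 0 < u) : (floorDiffs u v).sum = v := by
  have := sum_map_range_sub _ (floor_mono u v) u
  simpa [floorDiffs, Nat.mul_div_cancel_left v hu] using this

lemma ceilDiffs_bounds {u v : ℕ} {l : ℕ} (hl : l ∈ ceilDiffs u v) :
    l * v < u + v ∧ u < l * v + v := by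
  obtain ⟨j, hj, rfl⟩ := List.mem_map.1 hl
  have hv : 0 < v := by have := List.mem_range.1 hj; omega
  have hm := ceil_mono u v (Nat.le_succ j)
  simp only [Nat.succ_eq_add_one] at hm
  have e1 := Nat.div_add_mod ((j + 1) * u + (v - 1)) v
  have e2 := Nat.div_add_mod (j * u + (v - 1)) v
  have l1 := Nat.mod_lt ((j + 1) * u + (v - 1)) hv
  have l2 := Nat.mod_lt (j * u + (v - 1)) hv
  set X := ((j + 1) * u + (v - 1)) / v
  set Y := (j * u + (v - 1)) / v
  obtain ⟨d, hd⟩ := Nat.exists_eq_add_of_le hm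
  rw [hd, Nat.add_sub_cancel_left]
  rw [hd] at e1
  have : (j + 1) * u = j * u + u := by ring
  have : v * (Y + d) = v * Y + d * v := by ring
  omega

lemma floorDiffs_bounds {u v : ℕ} {l : ℕ} (hl : l ∈ floorDiffs u v) :
    l * u < v + u ∧ v < l * u + u := by
  obtain ⟨j, hj, rfl⟩ := List.mem_map.1 hl
  have hu : 0 < u := by have := List.mem_range.1 hj; omega
  have hm := floor_mono u v (Nat.le_succ j)
  simp only [Nat.succ_eq_add_one] at hm
  have e1 := Nat.div_add_mod ((j + 1) * v) u
  have e2 := Nat.div_add_mod (j * v) u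
  have l1 := Nat.mod_lt ((j + 1) * v) hu
  have l2 := Nat.mod_lt (j * v) hu
  set X := ((j + 1) * v) / u
  set Y := (j * v) / u
  obtain ⟨d, hd⟩ := Nat.exists_eq_add_of_le hm
  rw [hd, Nat.add_sub_cancel_left]
  rw [hd] at e1
  have : (j + 1) * v = j * v + v := by ring
  have : u * (Y + d) = u * Y + d * u := by ring
  omega

lemma sturm_eq_floorDiffs {u : ℕ} (v : ℕ) (hu : 0 < u) (α β : G) :
    sturm u v α β = ((floorDiffs u v).map fun h => α * β ^ h).prod := by
  have key : ∀ N, ((List.range N).map fun i => β ^ (i * v / u) * α * (β ^ (i * v / u))⁻¹).prod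
      * β ^ (N * v / u) = ((List.range N).map
        ((fun h => α * β ^ h) ∘ fun i => (i + 1) * v / u - i * v / u)).prod := by
    intro N
    induction N with
    | zero => simp
    | succ N ih =>
      have hm : N * v / u ≤ (N + 1) * v / u := floor_mono u v (Nat.le_succ N)
      obtain ⟨d, hd⟩ := Nat.exists_eq_add_of_le hm
      rw [List.range_succ, List.map_append, List.map_append, List.prod_append, List.prod_append,
        ← ih, hd]
      simp only [List.map_cons, List.map_nil, List.prod_cons, List.prod_nil, mul_one,
        Function.comp_apply, hd, Nat.add_sub_cancel_left, pow_add]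
      group
  have := key u
  rw [Nat.mul_div_cancel_left v hu] at this
  rw [sturm, this, floorDiffs, List.map_map]

lemma sturm_eq_ceilDiffs (u : ℕ) {v : ℕ} (hv : 0 < v) (α β : G) :
    sturm u v α β = ((ceilDiffs u v).map fun h => α ^ h * β).prod := by
  have key : ∀ N, ((List.range ((N * u + (v - 1)) / v)).map
        fun i => β ^ (i * v / u) * α * (β ^ (i * v / u))⁻¹).prod
      * β ^ N = ((List.range N).map ((fun h => α ^ h * β) ∘
        fun j => ((j + 1) * u + (v - 1)) / v - (j * u + (v - 1)) / v)).prod := by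
    intro N
    induction N with
    | zero => rw [ceil_zero]; simp
    | succ N ih =>
      have hm : (N * u + (v - 1)) / v ≤ ((N + 1) * u + (v - 1)) / v :=
        ceil_mono u v (Nat.le_succ N)
      obtain ⟨d, hd⟩ := Nat.exists_eq_add_of_le hm
      have hblock : ((List.range d).map ((fun i => β ^ (i * v / u) * α * (β ^ (i * v / u))⁻¹) ∘
          (fun x => (N * u + (v - 1)) / v + x))).prod = β ^ N * α ^ d * (β ^ N)⁻¹ := by
        have hc : ∀ x ∈ List.range d, ((fun i => β ^ (i * v / u) * α * (β ^ (i * v / u))⁻¹) ∘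
          (fun x => (N * u + (v - 1)) / v + x)) x = β ^ N * α * (β ^ N)⁻¹ := by
          intro x hx
          have hx := List.mem_range.1 hx
          have e1 := Nat.div_add_mod ((N + 1) * u + (v - 1)) v
          have e2 := Nat.div_add_mod (N * u + (v - 1)) v
          have l1 := Nat.mod_lt ((N + 1) * u + (v - 1)) hv
          have l2 := Nat.mod_lt (N * u + (v - 1)) hv
          rw [hd] at e1
          have : ((N * u + (v - 1)) / v + x) * v / u = N := by
            set Y := (N * u + (v - 1)) / v
            have h3 : v * (Y + x) + v ≤ v * (Y + d) := by
              rw [← mul_add_one]; exact Nat.mul_le_mul_left _ (by omega)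
            have h4 : (N + 1) * u = N * u + u := by ring
            have h5 : v * (Y + x) = v * Y + v * x := by ring
            apply Nat.div_eq_of_lt_le
            · rw [mul_comm (Y + x)]; omega
            · rw [mul_comm (Y + x)]; omega
          simp only [Function.comp_apply, this]
        rw [List.map_congr_left hc]
        simp [conj_pow]
      rw [hd, List.range_add, List.map_append, List.prod_append, List.map_map, hblock,
        List.range_succ, List.map_append, List.prod_append, ← ih]
      simp only [List.map_cons, List.map_nil, List.prod_cons, List.prod_nil, mul_one,
        Function.comp_apply, hd, Nat.add_sub_cancel_left]
      rw [pow_succ]; group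
  have := key v
  rw [ceil_top u hv] at this
  rw [sturm, this, ceilDiffs, List.map_map]

lemma sturm_add_left (u v : ℕ) (α β : G) :
    sturm (u + v) v α β = sturm u v α (α * β) := by
  rcases Nat.eq_zero_or_pos v with rfl | hv
  · simp [sturm]
  · rw [sturm_eq_ceilDiffs _ hv, sturm_eq_ceilDiffs _ hv]
    have : ceilDiffs (u + v) v = (ceilDiffs u v).map (· + 1) := by
      rw [ceilDiffs, ceilDiffs, List.map_map]
      apply List.map_congr_left
      intro j _
      have h1 : ∀ j, (j * (u + v) + (v - 1)) / v = (j * u + (v - 1)) / v + j := by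
        intro j
        rw [show j * (u + v) + (v - 1) = (j * u + (v - 1)) + v * j by ring,
          Nat.add_mul_div_left _ _ hv]
      have := ceil_mono u v (Nat.le_succ j)
      simp only [Function.comp_apply, h1, Nat.succ_eq_add_one] at *
      omega
    rw [this, List.map_map]
    congr 1
    apply List.map_congr_left
    intro h _
    simp [pow_succ, mul_assoc]

lemma sturm_add_right (u v : ℕ) (α β : G) :
    sturm u (u + v) α β = sturm u v (α * β) β := by
  rcases Nat.eq_zero_or_pos u with rfl | hu
  · simp [sturm]
  · rw [sturm_eq_floorDiffs _ hu, sturm_eq_floorDiffs _ hu]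
    have : floorDiffs u (u + v) = (floorDiffs u v).map (· + 1) := by
      rw [floorDiffs, floorDiffs, List.map_map]
      apply List.map_congr_left
      intro j _
      have h1 : ∀ j, (j * (u + v)) / u = j * v / u + j := by
        intro j
        rw [show j * (u + v) = j * v + u * j by ring, Nat.add_mul_div_left _ _ hu]
      have := floor_mono u v (Nat.le_succ j)
      simp only [Function.comp_apply, h1, Nat.succ_eq_add_one] at *
      omega
    rw [this, List.map_map]
    congr 1
    apply List.map_congr_left
    intro h _
    simp [pow_succ', mul_assoc]

lemma sturm_add_mul_left (u v m : ℕ) (α β : G) :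
    sturm (u + m * v) v α β = sturm u v α (α ^ m * β) := by
  induction m generalizing β with
  | zero => simp
  | succ m ih =>
    rw [show u + (m + 1) * v = u + m * v + v by ring, sturm_add_left, ih, pow_succ, mul_assoc]

lemma prod_map_conj {ι : Type*} (g : G) (f : ι → G) (l : List ι) :
    (l.map fun i => g * f i * g⁻¹).prod = g * (l.map f).prod * g⁻¹ := by
  have := map_list_prod (MulAut.conj g) (l.map f)
  simpa [List.map_map, Function.comp_def] using this.symm

end Sturmian

section Representation

/-- The absolute value of the trace of an invertible real `2 × 2` matrix. -/
noncomputable def absTrace (g : GL (Fin 2) ℝ) : ℝ := |(g : Matrix (Fin 2) (Fin 2) ℝ).trace|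

lemma absTrace_conj (g x : GL (Fin 2) ℝ) : absTrace (g * x * g⁻¹) = absTrace x := by
  simp only [absTrace, Units.val_mul]
  rw [Matrix.trace_units_conj]

lemma absTrace_mul_comm (g x : GL (Fin 2) ℝ) : absTrace (g * x) = absTrace (x * g) := by
  simp only [absTrace, Units.val_mul]
  rw [Matrix.trace_mul_comm]

lemma absTrace_neg (x : GL (Fin 2) ℝ) : absTrace (-x) = absTrace x := by
  simp [absTrace, Matrix.trace_neg]

lemma absTrace_neg_one_zpow_mul (k : ℤ) (x : GL (Fin 2) ℝ) :
    absTrace ((-1) ^ k * x) = absTrace x := by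
  rcases Int.even_or_odd k with h | h
  · rw [h.neg_one_zpow, one_mul]
  · rw [h.neg_one_zpow, neg_one_mul, absTrace_neg]

lemma val_inv_of_det_eq_one {x : GL (Fin 2) ℝ} (hx : (x : Matrix (Fin 2) (Fin 2) ℝ).det = 1) :
    ((x⁻¹ : GL (Fin 2) ℝ) : Matrix (Fin 2) (Fin 2) ℝ) = !![x 1 1, -x 0 1; -x 1 0, x 0 0] := by
  rw [Matrix.coe_units_inv, Matrix.inv_def, hx, Matrix.adjugate_fin_two]
  simp

lemma absTrace_inv {x : GL (Fin 2) ℝ} (hx : (x : Matrix (Fin 2) (Fin 2) ℝ).det = 1) :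
    absTrace x⁻¹ = absTrace x := by
  rw [absTrace, val_inv_of_det_eq_one hx, absTrace, Matrix.trace_fin_two, Matrix.trace_fin_two]
  simp [add_comm]

/-- Pairs `(A, Q)` of matrices giving rise to a representation of the Heckoid group for
`r = [m, 2]`, the trace of the generator of the relevant cyclic group being `2 cos φ`. -/
structure IsRep (m : ℕ) (φ : ℝ) (A Q : GL (Fin 2) ℝ) : Prop where
  detA : (A : Matrix (Fin 2) (Fin 2) ℝ).det = 1
  detQ : (Q : Matrix (Fin 2) (Fin 2) ℝ).det = 1
  sq : Q * Q = -1
  invol : ∃ W : GL (Fin 2) ℝ, W * W = 1 ∧ W * A⁻¹ * W = Q * A * Q⁻¹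
  tr : ((A ^ (m + 1) * Q * (A ^ m * Q) : GL (Fin 2) ℝ) : Matrix (Fin 2) (Fin 2) ℝ).trace
    = 2 * Real.cos φ

lemma sin_smul_pow_succ {Z : Matrix (Fin 2) (Fin 2) ℝ} {φ : ℝ} (hd : Z.det = 1)
    (ht : Z.trace = 2 * Real.cos φ) (k : ℕ) :
    Real.sin φ • Z ^ (k + 1) = Real.sin ((k + 1 : ℕ) * φ) • Z - Real.sin (k * φ) • 1 := by
  have hZ : Z * Z = (2 * Real.cos φ) • Z - 1 := by
    rw [Matrix.det_fin_two] at hd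
    rw [← ht, Matrix.trace_fin_two]
    ext i j
    fin_cases i <;> fin_cases j <;> simp [Matrix.mul_apply] <;>
      first | ring1 | linear_combination -hd
  induction k with
  | zero => simp
  | succ k ih =>
    rw [pow_succ, ← smul_mul_assoc, ih, sub_mul, smul_mul_assoc, hZ, smul_mul_assoc, one_mul,
      smul_sub, smul_smul]
    have h1 : Real.sin ((k + 1 + 1 : ℕ) * φ) =
        Real.sin ((k + 1 : ℕ) * φ) * (2 * Real.cos φ) - Real.sin (k * φ) := by
      have e1 : ((k + 1 + 1 : ℕ) : ℝ) * φ = (k + 1 : ℕ) * φ + φ := by push_cast; ring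
      have e2 : (k : ℝ) * φ = (k + 1 : ℕ) * φ - φ := by push_cast; ring
      rw [e1, e2, Real.sin_add, Real.sin_sub]; ring
    rw [h1, sub_smul]
    abel

lemma pow_eq_neg_one_zpow {Z : GL (Fin 2) ℝ} {φ : ℝ}
    (hd : (Z : Matrix (Fin 2) (Fin 2) ℝ).det = 1)
    (ht : (Z : Matrix (Fin 2) (Fin 2) ℝ).trace = 2 * Real.cos φ)
    (hφ : Real.sin φ ≠ 0) {N : ℕ} (hN : 0 < N) (hs : Real.sin (N * φ) = 0) :
    ∃ k : ℤ, Z ^ N = (-1) ^ k := by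
  obtain ⟨N, rfl⟩ := Nat.exists_eq_add_of_le' hN
  have h := sin_smul_pow_succ hd ht N
  rw [hs, zero_smul, zero_sub] at h
  have h2 : Real.sin (N * φ) = - (Real.cos ((N + 1 : ℕ) * φ) * Real.sin φ) := by
    have : (N : ℝ) * φ = (N + 1 : ℕ) * φ - φ := by push_cast; ring
    rw [this, Real.sin_sub, hs]; ring
  have h3 : ((Z : Matrix (Fin 2) (Fin 2) ℝ)) ^ (N + 1) =
      Real.cos ((N + 1 : ℕ) * φ) • (1 : Matrix (Fin 2) (Fin 2) ℝ) := by
    apply smul_right_injective _ hφ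
    simp only
    rw [h, h2, neg_smul, neg_neg, smul_smul, mul_comm]
  have h4 := Real.sin_sq_add_cos_sq ((N + 1 : ℕ) * φ)
  rw [hs] at h4
  have h5 : Real.cos ((N + 1 : ℕ) * φ) = 1 ∨ Real.cos ((N + 1 : ℕ) * φ) = -1 :=
    sq_eq_one_iff.1 (by linarith)
  rcases h5 with h5 | h5
  · refine ⟨0, Units.ext ?_⟩
    rw [h5, one_smul] at h3
    simpa using h3
  · refine ⟨1, Units.ext ?_⟩
    rw [h5, neg_one_smul] at h3
    simpa using h3

variable {m : ℕ} {φ : ℝ} {A Q : GL (Fin 2) ℝ}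

/-- The absolute trace of the image of `u_s`. -/
noncomputable def slopeTrace (A Q : GL (Fin 2) ℝ) (s : ℚ) : ℝ :=
  absTrace (sturm (2 * s.den) (2 * s.num.toNat) A Q)

lemma pow_two_mul_eq (hQ : Q * Q = -1) (k : ℕ) : Q ^ (2 * k) = (-1) ^ (k : ℤ) := by
  rw [pow_mul, pow_two, hQ, zpow_natCast]

lemma conj_pow_eq (hQ : Q * Q = -1) (f : ℕ) :
    Q ^ f * A * (Q ^ f)⁻¹ = if Even f then A else Q * A * Q⁻¹ := by
  have hc : ∀ k : ℕ, ∀ x : GL (Fin 2) ℝ, (-1 : GL (Fin 2) ℝ) ^ k * x * ((-1) ^ k)⁻¹ = x := by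
    intro k x
    rcases neg_one_pow_eq_or (GL (Fin 2) ℝ) k with h | h <;> rw [h] <;> simp
  rcases Nat.even_or_odd' f with ⟨k, rfl | rfl⟩
  · simp only [even_two, Even.mul_right, if_true]
    rw [pow_mul, pow_two, hQ, hc]
  · rw [if_neg (by simp), pow_succ', mul_inv_rev, pow_mul, pow_two, hQ]
    calc _ = Q * ((-1) ^ k * A * ((-1) ^ k)⁻¹) * Q⁻¹ := by group
      _ = _ := by rw [hc]

lemma floor_mul_eq {s : ℚ} (hs : 0 ≤ s) (i : ℕ) :
    ⌊(i : ℚ) * s⌋.toNat = i * (2 * s.num.toNat) / (2 * s.den) := by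
  have h1 : (i : ℚ) * s = ((i * s.num.toNat : ℕ) : ℚ) / (s.den : ℚ) := by
    have h2 : ((s.num.toNat : ℕ) : ℚ) = (s.num : ℚ) := by
      have := Int.toNat_of_nonneg (Rat.num_nonneg.2 hs)
      exact_mod_cast this
    push_cast
    rw [h2, mul_div_assoc, Rat.num_div_den]
  rw [h1, Int.floor_toNat, Nat.floor_div_eq_div,
    show i * (2 * s.num.toNat) = 2 * (i * s.num.toNat) by ring,
    Nat.mul_div_mul_left _ _ (by norm_num)]

lemma exists_hom (h : IsRep m φ A Q) : ∃ Φ : F →* GL (Fin 2) ℝ, ∀ s : ℚ, 0 ≤ s →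
    ∃ k : ℤ, Φ (uWord s) = (-1) ^ k * sturm (2 * s.den) (2 * s.num.toNat) A Q := by
  obtain ⟨W, hW, hWA⟩ := h.invol
  refine ⟨FreeGroup.lift fun i => if i = 0 then A * W else W * A, fun s hs => ?_⟩
  set Φ : F →* GL (Fin 2) ℝ := FreeGroup.lift fun i => if i = 0 then A * W else W * A with hΦ
  have hWi : W⁻¹ = W := inv_eq_of_mul_eq_one_left hW
  have hgen : ∀ i f : ℕ, Φ (gen i ^ ((-1 : ℤ) ^ f)) =
      if Even i then Q ^ f * A * (Q ^ f)⁻¹ * W else W * (Q ^ f * A * (Q ^ f)⁻¹) := by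
    intro i f
    rw [conj_pow_eq h.sq, map_zpow]
    have hg : Φ (gen i) = if Even i then A * W else W * A := by
      rw [hΦ, gen, FreeGroup.lift_apply_of]
      simp [Fin.ext_iff, Nat.even_iff]
    rw [hg, ← hWA]
    rcases Nat.even_or_odd f with hf | hf
    · rw [hf.neg_one_pow, if_pos hf, zpow_one]
    · rw [hf.neg_one_pow, if_neg (Nat.not_even_iff_odd.2 hf), zpow_neg_one]
      split_ifs
      · rw [mul_inv_rev, hWi, mul_assoc (W * A⁻¹), hW, mul_one]
      · rw [mul_inv_rev, hWi, ← mul_assoc, ← mul_assoc, hW, one_mul]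
  have key : ∀ (f : ℕ → ℕ) (N : ℕ),
      ((List.range N).map fun i => Φ (gen i ^ ((-1 : ℤ) ^ f i))).prod =
      ((List.range N).map fun i => Q ^ f i * A * (Q ^ f i)⁻¹).prod * (if Even N then 1 else W) := by
    intro f N
    induction N with
    | zero => simp
    | succ N ih =>
      rw [List.range_succ, List.map_append, List.map_append, List.prod_append, List.prod_append,
        ih]
      simp only [List.map_cons, List.map_nil, List.prod_cons, List.prod_nil, mul_one, hgen]
      by_cases hN : Even N
      · rw [if_pos hN, if_pos hN, if_neg (by simpa using hN.add_one)]
        simp only [mul_assoc, mul_one]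
      · rw [if_neg hN, if_neg hN, if_pos (by simpa using (Nat.not_even_iff_odd.1 hN).add_one)]
        rw [mul_one, mul_assoc _ W, ← mul_assoc W, hW, one_mul]
  refine ⟨-(s.num.toNat : ℤ), ?_⟩
  rw [uWord, map_list_prod, List.map_map]
  have := key (fun i => i * (2 * s.num.toNat) / (2 * s.den)) (2 * s.den)
  simp only [even_two, Even.mul_right, if_true, mul_one] at this
  have e : (⇑Φ ∘ fun i => gen i ^ (-1 : ℤ) ^ ⌊(i : ℚ) * s⌋.toNat) =
      fun i => Φ (gen i ^ ((-1 : ℤ) ^ (i * (2 * s.num.toNat) / (2 * s.den)))) := by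
    funext i
    simp only [Function.comp_apply, floor_mul_eq hs]
  rw [e, this, sturm, pow_two_mul_eq h.sq]
  rcases Int.even_or_odd (s.num.toNat : ℤ) with h | h
  · rw [zpow_neg, h.neg_one_zpow]; simp
  · rw [zpow_neg, h.neg_one_zpow]; simp

lemma det_prod_map {ι : Type*} (f : ι → GL (Fin 2) ℝ) (l : List ι)
    (hf : ∀ i, (f i : Matrix (Fin 2) (Fin 2) ℝ).det = 1) :
    ((l.map f).prod : GL (Fin 2) ℝ).val.det = 1 := by
  induction l with
  | nil => simp
  | cons i l ih =>
    rw [List.map_cons, List.prod_cons, Units.val_mul, Matrix.det_mul, ih, hf, one_mul]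

lemma det_pow_val {x : GL (Fin 2) ℝ} (hx : x.val.det = 1) (k : ℕ) : (x ^ k).val.det = 1 := by
  rw [Units.val_pow_eq_pow_val, Matrix.det_pow, hx, one_pow]

lemma det_inv_val {x : GL (Fin 2) ℝ} (hx : x.val.det = 1) : (x⁻¹).val.det = 1 := by
  have : (x * x⁻¹).val.det = 1 := by simp
  rw [Units.val_mul, Matrix.det_mul, hx, one_mul] at this
  exact this

lemma det_sturm (u v : ℕ) (hA : A.val.det = 1) (hQ : Q.val.det = 1) :
    (sturm u v A Q).val.det = 1 := by
  rw [sturm, Units.val_mul, Matrix.det_mul, det_pow_val hQ, mul_one]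
  apply det_prod_map
  intro i
  rw [Units.val_mul, Units.val_mul, Matrix.det_mul, Matrix.det_mul, det_inv_val (det_pow_val hQ _),
    det_pow_val hQ, hA, one_mul, one_mul]

lemma sturm_slope (m : ℕ) (A Q : GL (Fin 2) ℝ) : sturm (2 * (2 * m + 1)) (2 * 2) A Q =
    (A * (A ^ m * Q) * (A ^ m * Q)) ^ 2 := by
  rw [show 2 * (2 * m + 1) = 2 + m * (2 * 2) by ring, sturm_add_mul_left,
    show 2 * 2 = 2 + (2 + 0) by rfl, sturm_add_right, sturm_add_right]
  simp [sturm, pow_two]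

lemma cfQ_num_den {m : ℕ} (hm : 2 ≤ m) : (cfQ [m, 2]).num.toNat = 2 ∧ (cfQ [m, 2]).den = 2 * m + 1
    ∧ 0 ≤ cfQ [m, 2] := by
  have h : cfQ [m, 2] = ((2 : ℤ) : ℚ) / ((2 * m + 1 : ℕ) : ℤ) := by
    have : (0 : ℚ) < m := by exact_mod_cast (by omega : 0 < m)
    simp only [cfQ]
    push_cast
    field_simp
    ring
  have hc : Nat.Coprime (Int.natAbs 2) (Int.natAbs ((2 * m + 1 : ℕ) : ℤ)) := by
    simp [Nat.coprime_two_left]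
  have hp : (0 : ℤ) < ((2 * m + 1 : ℕ) : ℤ) := by positivity
  have h1 := Rat.num_div_eq_of_coprime hp hc
  have h2 := Rat.den_div_eq_of_coprime hp hc
  rw [h]
  refine ⟨by rw [h1]; rfl, by exact_mod_cast h2, by positivity⟩

theorem slopeTrace_eq {m n : ℕ} {φ : ℝ} (hm : 2 ≤ m) (hn : 0 < n) (hφ : Real.sin φ ≠ 0)
    (hs : Real.sin ((2 * n : ℕ) * φ) = 0) {s s' : ℚ} (h0 : 0 ≤ s) (h0' : 0 ≤ s')
    (hc : IsConj (heckQ (cfQ [m, 2]) n (uWord s)) (heckQ (cfQ [m, 2]) n (uWord s')) ∨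
      IsConj (heckQ (cfQ [m, 2]) n (uWord s)) ((heckQ (cfQ [m, 2]) n (uWord s'))⁻¹))
    {A Q : GL (Fin 2) ℝ} (h : IsRep m φ A Q) : slopeTrace A Q s = slopeTrace A Q s' := by
  obtain ⟨Φ, hΦ⟩ := exists_hom h
  have hN : heckN (cfQ [m, 2]) n ≤ (Subgroup.zpowers (-1 : GL (Fin 2) ℝ)).comap Φ := by
    have hnorm : (Subgroup.zpowers (-1 : GL (Fin 2) ℝ)).Normal := by
      refine ⟨fun x hx g => ?_⟩
      obtain ⟨k, rfl⟩ := hx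
      refine ⟨k, ?_⟩
      rcases Int.even_or_odd k with h | h <;> simp [h.neg_one_zpow]
    have : ((Subgroup.zpowers (-1 : GL (Fin 2) ℝ)).comap Φ).Normal := hnorm.comap Φ
    apply Subgroup.normalClosure_le_normal
    rw [Set.singleton_subset_iff]
    obtain ⟨e1, e2, e3⟩ := cfQ_num_den hm
    obtain ⟨k, hk⟩ := hΦ _ e3
    rw [e1, e2, sturm_slope] at hk
    set Z := A * (A ^ m * Q) * (A ^ m * Q) with hZ
    have hdet : Z.val.det = 1 := by
      simp only [hZ, Units.val_mul, Units.val_pow_eq_pow_val, Matrix.det_mul, Matrix.det_pow,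
        h.detA, h.detQ]
      simp
    have htr : Z.val.trace = 2 * Real.cos φ := by
      rw [← h.tr, hZ, pow_succ']
      simp only [mul_assoc]
    obtain ⟨j, hj⟩ := pow_eq_neg_one_zpow hdet htr hφ (by omega : 0 < 2 * n) hs
    refine ⟨k * n + j, ?_⟩
    have hcomm : Commute ((-1 : GL (Fin 2) ℝ) ^ k) (Z ^ 2) := by
      rcases Int.even_or_odd k with h | h <;> rw [h.neg_one_zpow]
      · exact Commute.one_left _
      · exact Commute.neg_one_left _
    simp only [map_pow, hk]
    rw [hcomm.mul_pow, ← pow_mul, hj, zpow_add, zpow_mul, zpow_natCast]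
  have hmk : ∀ x y : F, heckQ (cfQ [m, 2]) n x = heckQ (cfQ [m, 2]) n y →
      absTrace (Φ x) = absTrace (Φ y) := by
    intro x y hxy
    rw [heckQ, QuotientGroup.mk'_apply, QuotientGroup.mk'_apply, QuotientGroup.eq] at hxy
    obtain ⟨k, hk⟩ := hN hxy
    have : Φ y = Φ x * (-1) ^ k := by
      simp only [map_mul, map_inv] at hk
      rw [hk]; group
    rw [this, absTrace_mul_comm, absTrace_neg_one_zpow_mul]
  have hval : ∀ t : ℚ, 0 ≤ t → absTrace (Φ (uWord t)) = slopeTrace A Q t := by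
    intro t ht
    obtain ⟨k, hk⟩ := hΦ t ht
    rw [hk, absTrace_neg_one_zpow_mul, slopeTrace]
  have hinv : absTrace (Φ (uWord s'))⁻¹ = absTrace (Φ (uWord s')) := by
    obtain ⟨k, hk⟩ := hΦ s' h0'
    have hk' : (Φ (uWord s'))⁻¹ =
        (-1) ^ (-k) * (sturm (2 * s'.den) (2 * s'.num.toNat) A Q)⁻¹ := by
      rw [hk, mul_inv_rev, zpow_neg]
      rcases Int.even_or_odd k with h | h <;> simp [h.neg_one_zpow]
    rw [hk', hk, absTrace_neg_one_zpow_mul, absTrace_neg_one_zpow_mul,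
      absTrace_inv (det_sturm _ _ h.detA h.detQ)]
  have hconj : ∀ x y : F, IsConj (heckQ (cfQ [m, 2]) n x) (heckQ (cfQ [m, 2]) n y) →
      absTrace (Φ x) = absTrace (Φ y) := by
    intro x y hxy
    obtain ⟨c, hc⟩ := isConj_iff.1 hxy
    obtain ⟨g, rfl⟩ := QuotientGroup.mk'_surjective _ c
    have := hmk (g * x * g⁻¹) y (by simpa [heckQ] using hc)
    rwa [map_mul, map_mul, map_inv, absTrace_conj] at this
  rw [← hval s h0, ← hval s' h0']
  rcases hc with hc | hc
  · exact hconj _ _ hc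
  · rw [← map_inv] at hc
    rw [hconj _ _ hc, map_inv, hinv]

end Representation

section Slopes

lemma slopeTrace_eq_ceilDiffs (A Q : GL (Fin 2) ℝ) {s : ℚ} (hs : 0 < s.num.toNat) :
    slopeTrace A Q s =
      absTrace ((ceilDiffs (2 * s.den) (2 * s.num.toNat)).map fun l => A ^ l * Q).prod := by
  rw [slopeTrace, sturm_eq_ceilDiffs _ (by omega)]

lemma slope_ceilDiffs_bounds {s : ℚ} {l : ℕ}
    (hl : l ∈ ceilDiffs (2 * s.den) (2 * s.num.toNat)) :
    l * s.num.toNat < s.den + s.num.toNat ∧ s.den < l * s.num.toNat + s.num.toNat := by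
  have h := ceilDiffs_bounds hl
  have : l * (2 * s.num.toNat) = 2 * (l * s.num.toNat) := by ring
  omega

/-- Combinatorial data of a slope `s` close to `2 / (2 * m + 1)`: the matrix of `u_s` is, up to
conjugation, inversion and sign, a product of the matrices `(PR)^k P`, where `P = A^m Q` and
`R = A^{m+1} Q`. -/
structure IsNear (m n : ℕ) (s : ℚ) (ks : List ℕ) : Prop where
  pos : 0 < ks.length
  bounds : ∀ k ∈ ks, k * ks.length < ks.sum + ks.length ∧ ks.sum < k * ks.length + ks.length
  le : ∀ k ∈ ks, k ≤ 2 * n - 1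
  trace : ∀ (φ : ℝ) (A Q : GL (Fin 2) ℝ), IsRep m φ A Q → Real.sin φ ≠ 0 →
    Real.sin ((2 * n : ℕ) * φ) = 0 →
    slopeTrace A Q s =
      absTrace (ks.map fun k => (A ^ m * Q * (A ^ (m + 1) * Q)) ^ k * (A ^ m * Q)).prod
  form : ∃ c : ℕ, s.den = m * s.num.toNat + c ∧ c ≤ s.num.toNat ∧
    ((ks.sum = 2 * c ∧ ks.length + 4 * c = 2 * s.num.toNat ∧ ks.sum < (2 * n - 2) * ks.length) ∨
    (ks.length + 2 * s.num.toNat = 4 * c ∧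
      ks.sum + 2 * s.num.toNat = (2 * n - 1) * ks.length + 2 * c
      ∧ (2 * n - 2) * ks.length ≤ ks.sum))

lemma prod_map_neg_one_zpow_mul_inv {ι : Type*} (f : ι → GL (Fin 2) ℝ) (j : ℤ) (l : List ι) :
    ∃ i : ℤ, (l.map fun k => (-1) ^ j * (f k)⁻¹).prod = (-1) ^ i * ((l.reverse.map f).prod)⁻¹ := by
  have hc : ∀ (i : ℤ) (x : GL (Fin 2) ℝ), x * (-1) ^ i = (-1) ^ i * x := by
    intro i x
    rcases Int.even_or_odd i with h | h <;> simp [h.neg_one_zpow]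
  induction l with
  | nil => exact ⟨0, by simp⟩
  | cons a l ih =>
    obtain ⟨i, hi⟩ := ih
    refine ⟨j + i, ?_⟩
    rw [List.map_cons, List.prod_cons, hi, List.reverse_cons, List.map_append, List.prod_append,
      mul_inv_rev, zpow_add]
    simp only [List.map_cons, List.map_nil, List.prod_cons, List.prod_nil, mul_one]
    rw [mul_assoc, ← mul_assoc (f a)⁻¹, hc, mul_assoc, mul_assoc]

lemma mul_pow_mul_eq {G : Type*} [Group G] (x y : G) (k : ℕ) :
    (x * y) ^ k * x = x * (y * x) ^ k := by
  induction k with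
  | zero => simp
  | succ k ih => rw [pow_succ, mul_assoc, mul_assoc x y x, ← mul_assoc, ih, mul_assoc, ← pow_succ]

lemma isNear_below {m n : ℕ} {s : ℚ} {c : ℕ} (hn : 2 ≤ n) (hd : s.den = m * s.num.toNat + c)
    (hc : c ≤ s.num.toNat) (h2 : 2 * s.num.toNat ≤ 3 * c) (hq : 0 < s.num.toNat) :
    ∃ ks, IsNear m n s ks := by
  set q := s.num.toNat with hqdef
  obtain ⟨L, hL⟩ : ∃ L, L + 2 * q = 4 * c := ⟨4 * c - 2 * q, by omega⟩
  obtain ⟨V, hV⟩ : ∃ V, V + 2 * c = 2 * q := ⟨2 * q - 2 * c, by omega⟩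
  have hL0 : 0 < L := by omega
  have hVL : V ≤ L := by omega
  have hbd : ∀ h ∈ floorDiffs L V, h ≤ 1 ∧ h * L < V + L ∧ V < h * L + L := by
    intro h hh
    have hb := floorDiffs_bounds hh
    refine ⟨?_, hb⟩
    by_contra hlt
    have : 2 * L ≤ h * L := Nat.mul_le_mul_right _ (by omega)
    omega
  set f : ℕ → ℕ := fun h => 2 * n - 1 - h with hf
  have hsum : ∀ l : List ℕ, (∀ h ∈ l, h ≤ 1) → (l.map f).sum + l.sum = (2 * n - 1) * l.length := by
    intro l hl
    induction l with
    | nil => simp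
    | cons a l ih =>
      have h1 := hl a (by simp)
      have h2 := ih fun h hh => hl h (by simp [hh])
      simp only [List.map_cons, List.sum_cons, List.length_cons, hf, mul_add_one] at *
      omega
  have hs := hsum _ fun h hh => (hbd h hh).1
  rw [sum_floorDiffs V hL0, length_floorDiffs] at hs
  have hlen : ((floorDiffs L V).map f).reverse.length = L := by simp
  have hsm : ((floorDiffs L V).map f).reverse.sum + V = (2 * n - 1) * L := by
    rw [List.sum_reverse, hs]
  refine ⟨((floorDiffs L V).map f).reverse, ?_, ?_, ?_, ?_, ?_⟩
  · rw [hlen]; exact hL0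
  · intro k hk
    rw [hlen]
    rw [List.mem_reverse, List.mem_map] at hk
    obtain ⟨h, hh, rfl⟩ := hk
    obtain ⟨b1, b2, b3⟩ := hbd h hh
    have : f h * L + h * L = (2 * n - 1) * L := by
      rw [← add_mul]; congr 1; simp only [hf]; omega
    omega
  · intro k hk
    rw [List.mem_reverse, List.mem_map] at hk
    obtain ⟨h, hh, rfl⟩ := hk
    simp only [hf]; omega
  · intro φ A Q hA hφ hsφ
    set P := A ^ m * Q with hP
    set R := A ^ (m + 1) * Q with hR
    have hRA : R = A * P := by rw [hR, hP, pow_succ', mul_assoc]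
    have hdet : (P * R).val.det = 1 := by
      simp only [hP, hR, Units.val_mul, Units.val_pow_eq_pow_val, Matrix.det_mul, Matrix.det_pow,
        hA.detA, hA.detQ, one_pow, one_mul]
    have htr : (P * R).val.trace = 2 * Real.cos φ := by
      rw [← hA.tr, Units.val_mul, Matrix.trace_mul_comm, ← Units.val_mul]
    obtain ⟨j, hj⟩ := pow_eq_neg_one_zpow hdet htr hφ (by omega : 0 < 2 * n) hsφ
    have e1 : sturm (2 * s.den) (2 * q) A Q = sturm L V R (R * P) := by
      rw [hd, show 2 * (m * q + c) = 2 * c + m * (2 * q) by ring, sturm_add_mul_left,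
        show 2 * q = 2 * c + V by omega, sturm_add_right, show 2 * c = L + V by omega,
        sturm_add_left, hRA]
    rw [slopeTrace, e1, sturm_eq_floorDiffs _ hL0]
    have hcomm : ∀ (i : ℤ) (x : GL (Fin 2) ℝ), x * (-1) ^ i = (-1) ^ i * x := by
      intro i x
      rcases Int.even_or_odd i with h | h <;> simp [h.neg_one_zpow]
    have e2 : ((floorDiffs L V).map fun h => R * (R * P) ^ h) = (floorDiffs L V).map
        fun h => R * ((-1) ^ j * ((P * R) ^ f h * P)⁻¹) * R⁻¹ := by
      apply List.map_congr_left
      intro h hh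
      have h1 := (hbd h hh).1
      rw [eq_mul_inv_iff_mul_eq, mul_assoc]
      congr 1
      rw [eq_mul_inv_iff_mul_eq, mul_pow_mul_eq R P, mul_assoc R, ← mul_assoc (_ ^ h), ← pow_add,
        show h + f h = 2 * n - 1 by simp only [hf]; omega, mul_pow_mul_eq, ← mul_assoc]
      have h3 : (R * P) ^ (2 * n - 1) * (R * P) = (R * P) ^ (2 * n) := by
        rw [← pow_succ]; congr 1; omega
      have h4 : R * P * (R * P) ^ (2 * n - 1) = (R * P) ^ (2 * n) := by
        rw [← pow_succ']; congr 1; omega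
      rw [h4]
      have h5 : (R * P) ^ (2 * n) = P⁻¹ * (P * R) ^ (2 * n) * P := by
        have := mul_pow_mul_eq P R (2 * n)
        rw [mul_assoc P⁻¹, this, inv_mul_cancel_left]
      rw [h5, hj, hcomm, mul_assoc]; simp
    rw [e2, prod_map_conj, absTrace_conj]
    obtain ⟨i, hi⟩ := prod_map_neg_one_zpow_mul_inv (fun h => (P * R) ^ f h * P) j (floorDiffs L V)
    rw [hi, absTrace_neg_one_zpow_mul, absTrace_inv, ← List.map_reverse, List.map_map]
    · rfl
    · apply det_prod_map
      intro h
      rw [Units.val_mul, Matrix.det_mul, det_pow_val hdet, one_mul]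
      simp only [hP, Units.val_mul, Units.val_pow_eq_pow_val, Matrix.det_mul, Matrix.det_pow,
        hA.detA, hA.detQ, one_pow, one_mul]
  · refine ⟨c, hd, hc, Or.inr ?_⟩
    rw [hlen]
    refine ⟨hL, by omega, ?_⟩
    have : (2 * n - 1) * L = (2 * n - 2) * L + L := by
      rw [← add_one_mul]; congr 1; omega
    omega

lemma isNear_above {m n : ℕ} {s : ℚ} {c : ℕ} (hn : 2 ≤ n) (hd : s.den = m * s.num.toNat + c)
    (h2 : (4 * n - 3) * c < (2 * n - 2) * s.num.toNat) :
    ∃ ks, IsNear m n s ks := by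
  set q := s.num.toNat with hqdef
  have h3 : 2 * c < q := by
    by_contra hlt
    have : (2 * n - 2) * q ≤ (2 * n - 2) * (2 * c) := Nat.mul_le_mul_left _ (by omega)
    have : (4 * n - 3) * c = (2 * n - 2) * (2 * c) + c := by
      rw [show 4 * n - 3 = (2 * n - 2) * 2 + 1 by omega]; ring
    omega
  obtain ⟨L, hL⟩ : ∃ L, L + 4 * c = 2 * q := ⟨2 * q - 4 * c, by omega⟩
  have hL0 : 0 < L := by omega
  have hSL : 2 * c < (2 * n - 2) * L := by
    have e1 : (4 * n - 3) * c = (2 * n - 2) * (2 * c) + c := by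
      rw [show 4 * n - 3 = (2 * n - 2) * 2 + 1 by omega]; ring
    have e2 : (2 * n - 2) * (L + 4 * c) = 2 * ((2 * n - 2) * q) := by rw [hL]; ring
    have e3 : (2 * n - 2) * (L + 4 * c) = (2 * n - 2) * L + 2 * ((2 * n - 2) * (2 * c)) := by ring
    omega
  refine ⟨ceilDiffs (2 * c) L, ?_, ?_, ?_, ?_, ?_⟩
  · simpa using hL0
  · intro k hk
    rw [length_ceilDiffs, sum_ceilDiffs _ hL0]
    exact ceilDiffs_bounds hk
  · intro k hk
    have hb := (ceilDiffs_bounds hk).1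
    have : k * L < (2 * n - 1) * L := by
      rw [show 2 * n - 1 = 2 * n - 2 + 1 by omega, add_one_mul]; omega
    exact (Nat.lt_of_mul_lt_mul_right this).le
  · intro φ A Q hA hφ hsφ
    set P := A ^ m * Q with hP
    set R := A ^ (m + 1) * Q with hR
    have hRA : R = A * P := by rw [hR, hP, pow_succ', mul_assoc]
    have e1 : sturm (2 * s.den) (2 * q) A Q = sturm (2 * c) L (R * P) P := by
      rw [hd, show 2 * (m * q + c) = 2 * c + m * (2 * q) by ring, sturm_add_mul_left,
        show 2 * q = 2 * c + (2 * c + L) by omega, sturm_add_right, sturm_add_right, hRA]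
    rw [slopeTrace, e1, sturm_eq_ceilDiffs _ hL0, ← absTrace_conj P, ← prod_map_conj]
    congr 3
    funext k
    rw [mul_pow_mul_eq]
    group
  · refine ⟨c, hd, by omega, Or.inl ?_⟩
    rw [length_ceilDiffs, sum_ceilDiffs _ hL0]
    exact ⟨rfl, hL, hSL⟩

/-- The slopes in the two intervals are of one of three kinds. -/
lemma slope_cases {m n : ℕ} {s : ℚ} (hm : 2 ≤ m) (hn : 2 ≤ n)
    (h : memI1 [m, 2] n s ∨ memI2 [m, 2] n s) : 0 ≤ s ∧
      ((∃ c, s.den = m * s.num.toNat + c ∧ s.num.toNat < c) ∨ (∃ ks, IsNear m n s ks) ∨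
        (s.den < m * s.num.toNat ∧ s.num.toNat ≤ s.den)) := by
  have hm0 : (0 : ℚ) < m := by exact_mod_cast (by omega : 0 < m)
  have hn0 : (2 : ℚ) ≤ n := by exact_mod_cast hn
  have he : Even (List.length [m, 2]) := by simp
  simp only [memI1, memI2, if_pos he] at h
  have hs0 : 0 ≤ s := by
    rcases h with h | h
    · exact h.1
    · refine le_trans ?_ h.1.le
      have : (0 : ℚ) ≤ ((2 * n - 2 : ℕ) : ℚ) := by positivity
      simp only [cfQ, List.cons_append, List.nil_append]
      positivity
  refine ⟨hs0, ?_⟩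
  set q := s.num.toNat with hq
  have hqs : ((q : ℕ) : ℚ) = (s.num : ℚ) := by
    have := Int.toNat_of_nonneg (Rat.num_nonneg.2 hs0)
    exact_mod_cast this
  have hp0 : (0 : ℚ) < s.den := by exact_mod_cast s.den_pos
  have hsq : s = (q : ℚ) / (s.den : ℚ) := by rw [hqs, Rat.num_div_den]
  have hden := s.den_pos
  rcases h with ⟨-, h⟩ | ⟨h, h1⟩
  · have hle : (3 * m + 2) * q ≤ 3 * s.den := by
      have e : cfQ ([m, 2].dropLast ++ [[m, 2].getLast! - 1, 2]) = 3 / (3 * m + 2) := by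
        simp [cfQ, List.getLast!]
        field_simp
        ring
      rw [e, hsq, div_le_div_iff₀ hp0 (by positivity)] at h
      have : ((q * (3 * m + 2) : ℕ) : ℚ) ≤ ((3 * s.den : ℕ) : ℚ) := by push_cast; exact h
      have := Nat.cast_le.1 this
      rw [mul_comm]; exact this
    have e3 : (3 * m + 2) * q = 3 * (m * q) + 2 * q := by ring
    obtain ⟨c, hc⟩ := Nat.exists_eq_add_of_le (by omega : m * q ≤ s.den)
    by_cases hcq : q < c
    · exact Or.inl ⟨c, hc, hcq⟩
    · refine Or.inr (Or.inl (isNear_below hn hc (by omega) (by omega) ?_))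
      rcases Nat.eq_zero_or_pos q with h0 | h0
      · rw [h0] at hc hcq; omega
      · exact h0
  · have hlt : (4 * n - 3) * s.den < ((4 * n - 3) * m + (2 * n - 2)) * q := by
      obtain ⟨N, rfl⟩ := Nat.exists_eq_add_of_le hn
      have e : cfQ ([m, 2] ++ [2 * (2 + N) - 2]) =
          (4 * N + 5) / ((4 * N + 5) * m + (2 * N + 2)) := by
        rw [show 2 * (2 + N) - 2 = 2 * N + 2 by omega]
        have : (0 : ℚ) ≤ N := by positivity
        simp [cfQ]
        field_simp
        ring
      rw [e, hsq, div_lt_div_iff₀ (by positivity) hp0] at h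
      have h' : (((4 * N + 5) * s.den : ℕ) : ℚ) <
          ((q * ((4 * N + 5) * m + (2 * N + 2)) : ℕ) : ℚ) := by
        push_cast; exact h
      have h' := Nat.cast_lt.1 h'
      rw [show 4 * (2 + N) - 3 = 4 * N + 5 by omega, show 2 * (2 + N) - 2 = 2 * N + 2 by omega,
        mul_comm _ q]
      exact h'
    have hqp : q ≤ s.den := by
      rw [hsq, div_le_one hp0] at h1
      exact_mod_cast h1
    by_cases hcm : s.den < m * q
    · exact Or.inr (Or.inr ⟨hcm, hqp⟩)
    · obtain ⟨c, hc⟩ := Nat.exists_eq_add_of_le (by omega : m * q ≤ s.den)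
      refine Or.inr (Or.inl (isNear_above hn hc ?_))
      rw [hc] at hlt
      have : (4 * n - 3) * (m * q + c) = (4 * n - 3) * m * q + (4 * n - 3) * c := by ring
      have : ((4 * n - 3) * m + (2 * n - 2)) * q = (4 * n - 3) * m * q + (2 * n - 2) * q := by ring
      change (4 * n - 3) * c < (2 * n - 2) * q
      omega

lemma slope_ext {s s' : ℚ} (h : 0 ≤ s) (h' : 0 ≤ s') (hn : s.num.toNat = s'.num.toNat)
    (hd : s.den = s'.den) : s = s' := by
  apply Rat.ext _ hd
  rw [← Int.toNat_of_nonneg (Rat.num_nonneg.2 h), ← Int.toNat_of_nonneg (Rat.num_nonneg.2 h'), hn]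

end Slopes

section Limits

open Filter Topology

variable {X : Type*} {l : Filter X}

/-- The function `f` has a finite limit along `l`. -/
def Converges (l : Filter X) (f : X → ℝ) : Prop := ∃ y, Tendsto f l (𝓝 y)

lemma Converges.const (c : ℝ) : Converges l fun _ => c := ⟨c, tendsto_const_nhds⟩

lemma Converges.add {f g : X → ℝ} (hf : Converges l f) (hg : Converges l g) :
    Converges l fun x => f x + g x :=
  ⟨_, hf.choose_spec.add hg.choose_spec⟩

lemma Converges.mul {f g : X → ℝ} (hf : Converges l f) (hg : Converges l g) :
    Converges l fun x => f x * g x :=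
  ⟨_, hf.choose_spec.mul hg.choose_spec⟩

lemma Converges.neg {f : X → ℝ} (hf : Converges l f) : Converges l fun x => -f x :=
  ⟨_, hf.choose_spec.neg⟩

lemma Converges.pow {f : X → ℝ} (hf : Converges l f) (k : ℕ) : Converges l fun x => f x ^ k :=
  ⟨_, hf.choose_spec.pow k⟩

lemma Converges.list_prod {ι : Type*} {f : ι → X → ℝ} {L : List ι}
    (hf : ∀ i ∈ L, Converges l (f i)) : Converges l fun x => (L.map fun i => f i x).prod := by
  induction L with
  | nil => simpa using Converges.const 1
  | cons i L ih =>
    simp only [List.map_cons, List.prod_cons]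
    exact (hf i (by simp)).mul (ih fun j hj => hf j (by simp [hj]))

lemma order_le [l.NeBot] {μ f g : X → ℝ} (hμ : Tendsto μ l atTop) (hfg : f =ᶠ[l] g)
    {a b : ℕ} {x y : ℝ} (hf : Tendsto (fun i => f i / μ i ^ a) l (𝓝 x)) (hx : x ≠ 0)
    (hg : Tendsto (fun i => g i / μ i ^ b) l (𝓝 y)) : a ≤ b := by
  by_contra hlt
  obtain ⟨d, rfl⟩ := Nat.exists_eq_add_of_lt (not_le.1 hlt)
  have h1 : Tendsto (fun i => (μ i)⁻¹ ^ (d + 1)) l (𝓝 0) := by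
    simpa using (tendsto_inv_atTop_zero.comp hμ).pow (d + 1)
  have h2 := hg.mul h1
  rw [mul_zero] at h2
  refine hx (tendsto_nhds_unique (hf.congr' ?_) h2)
  filter_upwards [hfg, hμ.eventually_gt_atTop 0] with i hi hpos
  rw [hi, add_assoc, pow_add, inv_pow]
  field_simp

lemma limit_eq [l.NeBot] {μ f g : X → ℝ} (hfg : f =ᶠ[l] g)
    {a : ℕ} {x y : ℝ} (hf : Tendsto (fun i => f i / μ i ^ a) l (𝓝 x))
    (hg : Tendsto (fun i => g i / μ i ^ a) l (𝓝 y)) : x = y := by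
  refine tendsto_nhds_unique (hf.congr' ?_) hg
  filter_upwards [hfg] with i hi
  rw [hi]

lemma tendsto_matrix_fin_two {f : X → Matrix (Fin 2) (Fin 2) ℝ} {a b c d : ℝ}
    (ha : Tendsto (fun x => f x 0 0) l (𝓝 a)) (hb : Tendsto (fun x => f x 0 1) l (𝓝 b))
    (hc : Tendsto (fun x => f x 1 0) l (𝓝 c)) (hd : Tendsto (fun x => f x 1 1) l (𝓝 d)) :
    Tendsto f l (𝓝 !![a, b; c, d]) := by
  refine tendsto_pi_nhds.2 fun i => tendsto_pi_nhds.2 fun j => ?_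
  fin_cases i <;> fin_cases j <;> assumption

lemma tendsto_absTrace_prod {ι : Type*} {f : ι → X → GL (Fin 2) ℝ} {μ : X → ℝ}
    {M : ι → Matrix (Fin 2) (Fin 2) ℝ} {L : List ι} (hμ : ∀ᶠ x in l, 0 < μ x)
    (h : ∀ i ∈ L, Tendsto (fun x => (μ x)⁻¹ • (f i x).val) l (𝓝 (M i))) :
    Tendsto (fun x => absTrace (L.map fun i => f i x).prod / μ x ^ L.length) l
      (𝓝 |(L.map M).prod.trace|) := by
  have h1 : Tendsto (fun x => (L.map fun i => (μ x)⁻¹ • (f i x).val).prod) l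
      (𝓝 (L.map M).prod) := tendsto_list_prod L h
  have h2 : Continuous fun N : Matrix (Fin 2) (Fin 2) ℝ => |N.trace| :=
    (continuous_id.matrix_trace).abs
  refine ((h2.tendsto _).comp h1).congr' ?_
  filter_upwards [hμ] with x hx
  have h3 : ∀ L : List ι, (L.map fun i => (μ x)⁻¹ • (f i x).val).prod =
      ((μ x)⁻¹ ^ L.length) • ((L.map fun i => f i x).prod).val := by
    intro L
    induction L with
    | nil => simp
    | cons i L ih =>
      rw [List.map_cons, List.prod_cons, ih, List.map_cons, List.prod_cons, Units.val_mul,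
        smul_mul_smul_comm, List.length_cons, pow_succ']
  simp only [Function.comp_apply, h3, Matrix.trace_smul, smul_eq_mul, abs_mul, absTrace]
  rw [abs_of_pos (by positivity), inv_pow, div_eq_inv_mul]

lemma trace_prod_diag {ι : Type*} (a b : ι → ℝ) (L : List ι) :
    (L.map fun i => !![a i, 0; 0, b i]).prod.trace = (L.map a).prod + (L.map b).prod := by
  have h : (L.map fun i => !![a i, 0; 0, b i]).prod = !![(L.map a).prod, 0; 0, (L.map b).prod] := by
    induction L with
    | nil => simp [Matrix.one_fin_two]
    | cons i L ih => simp [ih]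
  rw [h]; simp [Matrix.trace_fin_two]

lemma abs_list_prod_map {ι : Type*} (a : ι → ℝ) (L : List ι) :
    |(L.map a).prod| = (L.map fun i => |a i|).prod := by
  induction L with
  | nil => simp
  | cons i L ih => simp [abs_mul, ih]

lemma exists_prod_form {ι : Type*} {ε : X → ℝ} (hε : Converges l ε) {α c a b : ι → X → ℝ}
    (L : List ι) (hL : L ≠ [])
    (h : ∀ i ∈ L, Converges l (α i) ∧ Converges l (c i) ∧ Converges l (a i) ∧ Converges l (b i)) :
    ∃ E C A B : X → ℝ, Converges l E ∧ Converges l C ∧ Converges l A ∧ Converges l B ∧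
      ∀ x, (L.map fun i => !![α i x, c i x; ε x * a i x, ε x * b i x]).prod =
        !![(L.map fun i => α i x).prod + ε x * E x, C x; ε x * A x, ε x * B x] := by
  induction L with
  | nil => exact absurd rfl hL
  | cons i L ih =>
    obtain ⟨h1, h2, h3, h4⟩ := h i (by simp)
    rcases eq_or_ne L [] with rfl | hne
    · exact ⟨fun _ => 0, c i, a i, b i, Converges.const 0, h2, h3, h4, fun x => by simp⟩
    · obtain ⟨E, C, A, B, hE, hC, hA, hB, hp⟩ := ih hne fun j hj => h j (by simp [hj])
      have hP : Converges l fun x => (L.map fun i => α i x).prod :=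
        Converges.list_prod fun j hj => (h j (by simp [hj])).1
      refine ⟨fun x => α i x * E x + c i x * A x, fun x => α i x * C x + c i x * (ε x * B x),
        fun x => a i x * ((L.map fun i => α i x).prod + ε x * E x) + b i x * (ε x * A x),
        fun x => a i x * C x + b i x * (ε x * B x), (h1.mul hE).add (h2.mul hA),
        (h1.mul hC).add (h2.mul (hε.mul hB)),
        (h3.mul (hP.add (hε.mul hE))).add (h4.mul (hε.mul hA)),
        (h3.mul hC).add (h4.mul (hε.mul hB)), fun x => ?_⟩
      rw [List.map_cons, List.prod_cons, hp, List.map_cons, List.prod_cons, Matrix.mul_fin_two]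
      ext j k
      fin_cases j <;> fin_cases k <;> simp <;> ring

end Limits

section Elliptic

open Filter Topology Real

lemma exists_sq_add_inv_sq {V : ℝ} (hV : 2 ≤ V) :
    ∃ μ : ℝ, 0 < μ ∧ V / 2 ≤ μ ^ 2 ∧ μ ^ 2 + (μ ^ 2)⁻¹ = V := by
  have h4 : 0 ≤ V ^ 2 - 4 := by nlinarith
  have hs := Real.sq_sqrt h4
  have hs0 := Real.sqrt_nonneg (V ^ 2 - 4)
  set t := (V + √(V ^ 2 - 4)) / 2 with ht
  have htpos : 0 < t := by rw [ht]; linarith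
  refine ⟨√t, Real.sqrt_pos.2 htpos, ?_, ?_⟩
  · rw [Real.sq_sqrt htpos.le, ht]; linarith
  · rw [Real.sq_sqrt htpos.le]
    have : t * t + 1 = V * t := by rw [ht]; nlinarith
    field_simp
    linarith

/-- The elliptic matrices: `A` is conjugate to a rotation by `θ`. -/
structure IsElliptic (m : ℕ) (φ θ μ : ℝ) (A Q : GL (Fin 2) ℝ) : Prop where
  isRep : IsRep m φ A Q
  pos : 0 < μ
  A_val : A.val = !![cos θ, -sin θ / μ; μ * sin θ, cos θ]
  Q_val : Q.val = !![0, -1; 1, 0]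
  rel : sin (m * θ) * sin ((m + 1 : ℕ) * θ) * (μ ^ 2 + (μ ^ 2)⁻¹) =
    2 * cos φ + 2 * (cos (m * θ) * cos ((m + 1 : ℕ) * θ))

lemma pow_val_of_elliptic {θ μ : ℝ} {A : GL (Fin 2) ℝ} (hμ : 0 < μ)
    (hA : A.val = !![cos θ, -sin θ / μ; μ * sin θ, cos θ]) (k : ℕ) :
    (A ^ k).val = !![cos (k * θ), -sin (k * θ) / μ; μ * sin (k * θ), cos (k * θ)] := by
  induction k with
  | zero => simp [Matrix.one_fin_two]
  | succ k ih =>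
    rw [pow_succ, Units.val_mul, ih, hA, Matrix.mul_fin_two]
    have e : ((k + 1 : ℕ) : ℝ) * θ = k * θ + θ := by push_cast; ring
    rw [e, cos_add, sin_add]
    ext i j
    fin_cases i <;> fin_cases j <;> simp <;> field_simp <;> ring

lemma pow_mul_val_of_elliptic {θ μ : ℝ} {A Q : GL (Fin 2) ℝ} (hμ : 0 < μ)
    (hA : A.val = !![cos θ, -sin θ / μ; μ * sin θ, cos θ]) (hQ : Q.val = !![0, -1; 1, 0])
    (k : ℕ) : (A ^ k * Q).val =
      !![-sin (k * θ) / μ, -cos (k * θ); cos (k * θ), -(μ * sin (k * θ))] := by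
  rw [Units.val_mul, pow_val_of_elliptic hμ hA, hQ, Matrix.mul_fin_two]
  simp

lemma exists_isElliptic {m : ℕ} {φ θ : ℝ} (hD : 0 < sin (m * θ) * sin ((m + 1 : ℕ) * θ))
    (hN : 2 * (sin (m * θ) * sin ((m + 1 : ℕ) * θ)) ≤
      2 * cos φ + 2 * (cos (m * θ) * cos ((m + 1 : ℕ) * θ))) :
    ∃ x : GL (Fin 2) ℝ × GL (Fin 2) ℝ × ℝ, IsElliptic m φ θ x.2.2 x.1 x.2.1 ∧
      (2 * cos φ + 2 * (cos (m * θ) * cos ((m + 1 : ℕ) * θ))) /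
        (sin (m * θ) * sin ((m + 1 : ℕ) * θ)) / 2 ≤ x.2.2 ^ 2 := by
  obtain ⟨μ, hμ, hle, hV⟩ := exists_sq_add_inv_sq ((le_div_iff₀ hD).2 hN)
  have hsc := sin_sq_add_cos_sq θ
  let A : GL (Fin 2) ℝ := ⟨!![cos θ, -sin θ / μ; μ * sin θ, cos θ],
    !![cos θ, sin θ / μ; -(μ * sin θ), cos θ],
    by
      rw [Matrix.mul_fin_two, Matrix.one_fin_two]
      ext i j
      fin_cases i <;> fin_cases j <;> simp <;> field_simp <;> linarith,
    by
      rw [Matrix.mul_fin_two, Matrix.one_fin_two]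
      ext i j
      fin_cases i <;> fin_cases j <;> simp <;> field_simp <;> linarith⟩
  let Q : GL (Fin 2) ℝ := ⟨!![0, -1; 1, 0], !![0, 1; -1, 0],
    by simp [Matrix.one_fin_two], by simp [Matrix.one_fin_two]⟩
  let W : GL (Fin 2) ℝ := ⟨!![0, 1; 1, 0], !![0, 1; 1, 0],
    by simp [Matrix.one_fin_two], by simp [Matrix.one_fin_two]⟩
  have hrel : sin (m * θ) * sin ((m + 1 : ℕ) * θ) * (μ ^ 2 + (μ ^ 2)⁻¹) =
    2 * cos φ + 2 * (cos (m * θ) * cos ((m + 1 : ℕ) * θ)) := by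
    rw [hV, mul_div_cancel₀ _ hD.ne']
  refine ⟨(A, Q, μ), ⟨⟨?_, ?_, ?_, ⟨W, ?_, ?_⟩, ?_⟩, hμ, rfl, rfl, hrel⟩, hle⟩
  · change Matrix.det !![cos θ, -sin θ / μ; μ * sin θ, cos θ] = 1
    rw [Matrix.det_fin_two_of]
    field_simp
    linarith
  · change Matrix.det !![(0 : ℝ), -1; 1, 0] = 1
    simp
  · apply Units.ext
    change !![(0 : ℝ), -1; 1, 0] * !![(0 : ℝ), -1; 1, 0] = -1
    simp [Matrix.one_fin_two]
  · apply Units.ext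
    change !![(0 : ℝ), 1; 1, 0] * !![(0 : ℝ), 1; 1, 0] = 1
    simp [Matrix.one_fin_two]
  · apply Units.ext
    change !![(0 : ℝ), 1; 1, 0] * !![cos θ, sin θ / μ; -(μ * sin θ), cos θ] * !![(0 : ℝ), 1; 1, 0] =
      !![(0 : ℝ), -1; 1, 0] * !![cos θ, -sin θ / μ; μ * sin θ, cos θ] * !![(0 : ℝ), 1; -1, 0]
    simp only [Matrix.mul_fin_two]
    ext i j
    fin_cases i <;> fin_cases j <;> simp [neg_div]
  · rw [Units.val_mul, pow_mul_val_of_elliptic hμ rfl rfl, pow_mul_val_of_elliptic hμ rfl rfl,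
      Matrix.mul_fin_two, Matrix.trace_fin_two]
    simp only [Matrix.of_apply, Matrix.cons_val', Matrix.cons_val_zero, Matrix.cons_val_one,
      Matrix.cons_val_fin_one]
    have h3 := hrel
    field_simp at h3 ⊢
    linear_combination h3

/-- A family of elliptic representations degenerating as `θ → θ₀`. -/
structure EllipticFamily (m : ℕ) (φ θ₀ : ℝ) (l : Filter ℝ) (A Q : ℝ → GL (Fin 2) ℝ)
    (μ : ℝ → ℝ) : Prop where
  neBot : l.NeBot
  le_nhds : l ≤ 𝓝 θ₀
  atTop : Tendsto μ l atTop
  ev : ∀ᶠ θ in l, IsElliptic m φ θ (μ θ) (A θ) (Q θ)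

lemma exists_ellipticFamily {m : ℕ} {φ θ₀ : ℝ} {l : Filter ℝ} [hl : l.NeBot] (hle : l ≤ 𝓝 θ₀)
    (hpos : ∀ᶠ θ in l, 0 < sin (m * θ) * sin ((m + 1 : ℕ) * θ))
    (h0 : sin (m * θ₀) * sin ((m + 1 : ℕ) * θ₀) = 0)
    (hN : 0 < 2 * cos φ + 2 * (cos (m * θ₀) * cos ((m + 1 : ℕ) * θ₀))) :
    ∃ A Q μ, EllipticFamily m φ θ₀ l A Q μ := by
  have hD : Tendsto (fun θ : ℝ => sin (m * θ) * sin ((m + 1 : ℕ) * θ)) l (𝓝 0) := by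
    rw [← h0]
    exact (Continuous.tendsto (by fun_prop) θ₀).mono_left hle
  have hN' : Tendsto (fun θ : ℝ => 2 * cos φ + 2 * (cos (m * θ) * cos ((m + 1 : ℕ) * θ))) l
      (𝓝 (2 * cos φ + 2 * (cos (m * θ₀) * cos ((m + 1 : ℕ) * θ₀)))) :=
    (Continuous.tendsto (by fun_prop) θ₀).mono_left hle
  have hlt : ∀ᶠ θ in l, 2 * (sin (m * θ) * sin ((m + 1 : ℕ) * θ)) <
      2 * cos φ + 2 * (cos (m * θ) * cos ((m + 1 : ℕ) * θ)) := by
    have h2 := hD.const_mul 2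
    rw [mul_zero] at h2
    exact h2.eventually_lt hN' hN
  have hex := (hpos.and hlt).mono fun θ h => exists_isElliptic h.1 h.2.le
  obtain ⟨f, hf⟩ := hex.choice
  refine ⟨fun θ => (f θ).1, fun θ => (f θ).2.1, fun θ => (f θ).2.2, hl, hle, ?_,
    hf.mono fun θ h => h.1⟩
  have hV : Tendsto (fun θ => (2 * cos φ + 2 * (cos (m * θ) * cos ((m + 1 : ℕ) * θ))) /
        (sin (m * θ) * sin ((m + 1 : ℕ) * θ)) / 2) l atTop := by
    refine Tendsto.atTop_div_const (by norm_num) ?_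
    simp only [div_eq_mul_inv _ (sin (_ * _) * _)]
    refine Tendsto.pos_mul_atTop hN hN' (Tendsto.inv_tendsto_nhdsGT_zero ?_)
    exact tendsto_nhdsWithin_iff.2 ⟨hD, hpos⟩
  have h2 : Tendsto (fun θ => (f θ).2.2 ^ 2) l atTop :=
    tendsto_atTop_mono' l (hf.mono fun θ h => h.2) hV
  have h3 := Real.tendsto_sqrt_atTop.comp h2
  refine h3.congr' (hf.mono fun θ h => ?_)
  simp only [Function.comp_apply]
  exact Real.sqrt_sq h.1.pos.le

variable {m n : ℕ} {φ θ₀ : ℝ} {l : Filter ℝ} {A Q : ℝ → GL (Fin 2) ℝ} {μ : ℝ → ℝ}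

lemma EllipticFamily.inv_tendsto (h : EllipticFamily m φ θ₀ l A Q μ) :
    Tendsto (fun θ => (μ θ)⁻¹) l (𝓝 0) := tendsto_inv_atTop_zero.comp h.atTop

lemma EllipticFamily.tendsto_continuous (h : EllipticFamily m φ θ₀ l A Q μ) {f : ℝ → ℝ}
    (hf : Continuous f) : Tendsto f l (𝓝 (f θ₀)) := (hf.tendsto θ₀).mono_left h.le_nhds

lemma EllipticFamily.tendsto_pow_mul (h : EllipticFamily m φ θ₀ l A Q μ) (k : ℕ) :
    Tendsto (fun θ => (μ θ)⁻¹ • (A θ ^ k * Q θ).val) l (𝓝 !![0, 0; 0, -sin (k * θ₀)]) := by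
  have hi := h.inv_tendsto
  have hs := h.tendsto_continuous (f := fun θ => sin (k * θ)) (by fun_prop)
  have hc := h.tendsto_continuous (f := fun θ => cos (k * θ)) (by fun_prop)
  have e : (fun θ => (μ θ)⁻¹ • !![-sin (k * θ) / μ θ, -cos (k * θ); cos (k * θ),
      -(μ θ * sin (k * θ))]) =ᶠ[l] fun θ => (μ θ)⁻¹ • (A θ ^ k * Q θ).val := by
    filter_upwards [h.ev] with θ hθ
    rw [pow_mul_val_of_elliptic hθ.pos hθ.A_val hθ.Q_val]
  refine Tendsto.congr' e (tendsto_matrix_fin_two ?_ ?_ ?_ ?_)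
  · have := hi.mul (hs.neg.mul hi)
    simpa [div_eq_mul_inv] using this
  · simpa using hi.mul hc.neg
  · simpa using hi.mul hc
  · refine hs.neg.congr' ?_
    filter_upwards [h.ev] with θ hθ
    have := hθ.pos
    simp
    field_simp

/-- The Chebyshev-type value `sin (kφ) / sin φ`. -/
noncomputable def cheb (φ : ℝ) (k : ℕ) : ℝ := sin (k * φ) / sin φ

lemma pow_mul_val_eq {A Q : GL (Fin 2) ℝ} (h : IsRep m φ A Q) (hφ : sin φ ≠ 0) (k : ℕ) :
    ((A ^ m * Q * (A ^ (m + 1) * Q)) ^ k * (A ^ m * Q)).val =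
      cheb φ (k + 1) • (A ^ m * Q).val - cheb φ k • (A ^ (m + 1) * Q).val.adjugate := by
  set P := A ^ m * Q with hP
  set R := A ^ (m + 1) * Q with hR
  have hd : ∀ j : ℕ, (A ^ j * Q).val.det = 1 := by
    intro j
    rw [Units.val_mul, Matrix.det_mul, det_pow_val h.detA, h.detQ, one_mul]
  have hdet : (P * R).val.det = 1 := by
    rw [Units.val_mul, Matrix.det_mul, hP, hR, hd, hd, one_mul]
  have htr : (P * R).val.trace = 2 * Real.cos φ := by
    rw [← h.tr, Units.val_mul, Matrix.trace_mul_comm, ← Units.val_mul]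
  have h1 := sin_smul_pow_succ hdet htr k
  have h2 : R.val * R.val.adjugate = 1 := by
    rw [Matrix.mul_adjugate, hR, hd, one_smul]
  have h3 := congrArg (· * R.val.adjugate) h1
  have h5 : (P * R).val * R.val.adjugate = P.val := by
    rw [Units.val_mul, Matrix.mul_assoc, h2, Matrix.mul_one]
  have h4 : (P * R).val ^ (k + 1) * R.val.adjugate = ((P * R) ^ k * P).val := by
    rw [pow_succ, Matrix.mul_assoc, h5, ← Units.val_pow_eq_pow_val, ← Units.val_mul]
  simp only [smul_mul_assoc, sub_mul, h4, h5, one_mul] at h3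
  apply smul_right_injective _ hφ
  simp only
  rw [h3, smul_sub, smul_smul, smul_smul, cheb, cheb, mul_div_cancel₀ _ hφ, mul_div_cancel₀ _ hφ]

lemma EllipticFamily.tendsto_near (h : EllipticFamily m φ θ₀ l A Q μ) (hφ : sin φ ≠ 0) (k : ℕ) :
    Tendsto (fun θ => (μ θ)⁻¹ • ((A θ ^ m * Q θ * (A θ ^ (m + 1) * Q θ)) ^ k *
      (A θ ^ m * Q θ)).val) l (𝓝 !![cheb φ k * sin ((m + 1 : ℕ) * θ₀), 0; 0,
        -(cheb φ (k + 1) * sin (m * θ₀))]) := by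
  have h1 := (h.tendsto_pow_mul m).const_smul (cheb φ (k + 1))
  have h2 := h.tendsto_pow_mul (m + 1)
  have h3 : Continuous fun M : Matrix (Fin 2) (Fin 2) ℝ => M.adjugate :=
    continuous_id.matrix_adjugate
  have h4 := ((h3.tendsto _).comp h2).const_smul (cheb φ k)
  have h5 := h1.sub h4
  have e : cheb φ (k + 1) • !![0, 0; 0, -sin (m * θ₀)] -
      cheb φ k • Matrix.adjugate !![0, 0; 0, -sin ((m + 1 : ℕ) * θ₀)] =
      !![cheb φ k * sin ((m + 1 : ℕ) * θ₀), 0; 0, -(cheb φ (k + 1) * sin (m * θ₀))] := by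
    rw [Matrix.adjugate_fin_two]
    ext i j
    fin_cases i <;> fin_cases j <;> simp
  rw [e] at h5
  refine h5.congr' ?_
  filter_upwards [h.ev] with θ hθ
  rw [pow_mul_val_eq hθ.isRep hφ]
  simp only [Function.comp_apply, Matrix.adjugate_fin_two]
  ext i j
  fin_cases i <;> fin_cases j <;> simp <;> ring

lemma EllipticFamily.tendsto_slopeTrace (h : EllipticFamily m φ θ₀ l A Q μ) {s : ℚ}
    (hs : 0 < s.num.toNat) :
    Tendsto (fun θ => slopeTrace (A θ) (Q θ) s / μ θ ^ (2 * s.num.toNat)) l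
      (𝓝 ((ceilDiffs (2 * s.den) (2 * s.num.toNat)).map fun k : ℕ => |sin (k * θ₀)|).prod) := by
  have h1 := tendsto_absTrace_prod (h.atTop.eventually_gt_atTop 0)
    (L := ceilDiffs (2 * s.den) (2 * s.num.toNat)) fun k _ => h.tendsto_pow_mul k
  rw [trace_prod_diag (fun _ => 0) (fun k : ℕ => -sin (k * θ₀))] at h1
  have h2 : ((ceilDiffs (2 * s.den) (2 * s.num.toNat)).map fun _ => (0 : ℝ)).prod = 0 := by
    rw [List.map_const', List.prod_replicate, length_ceilDiffs]
    exact zero_pow (by omega)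
  rw [h2, zero_add, abs_list_prod_map, length_ceilDiffs] at h1
  simp only [abs_neg] at h1
  refine h1.congr fun θ => ?_
  rw [slopeTrace_eq_ceilDiffs _ _ hs]

lemma EllipticFamily.tendsto_slopeTrace_zero (h : EllipticFamily m φ θ₀ l A Q μ) :
    Tendsto (fun θ => slopeTrace (A θ) (Q θ) 0 / μ θ ^ 0) l (𝓝 |2 * cos ((2 : ℕ) * θ₀)|) := by
  refine Tendsto.congr' ?_
    (h.tendsto_continuous (f := fun θ => |2 * cos ((2 : ℕ) * θ)|) (by fun_prop))
  filter_upwards [h.ev] with θ hθ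
  have : sturm (2 * (0 : ℚ).den) (2 * (0 : ℚ).num.toNat) (A θ) (Q θ) = A θ ^ 2 := by
    simp [sturm, pow_two]
  rw [slopeTrace, this, absTrace, pow_val_of_elliptic hθ.pos hθ.A_val, Matrix.trace_fin_two]
  simp [two_mul]

lemma EllipticFamily.tendsto_slopeTrace_near (h : EllipticFamily m φ θ₀ l A Q μ)
    (hφ : sin φ ≠ 0) (hφn : sin ((2 * n : ℕ) * φ) = 0) {s : ℚ} {ks : List ℕ}
    (hs : IsNear m n s ks) :
    Tendsto (fun θ => slopeTrace (A θ) (Q θ) s / μ θ ^ ks.length) l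
      (𝓝 |(ks.map fun k => cheb φ k * sin ((m + 1 : ℕ) * θ₀)).prod +
        (ks.map fun k => -(cheb φ (k + 1) * sin (m * θ₀))).prod|) := by
  have h1 := tendsto_absTrace_prod (h.atTop.eventually_gt_atTop 0)
    (L := ks) fun k _ => h.tendsto_near hφ k
  rw [trace_prod_diag] at h1
  refine h1.congr' ?_
  filter_upwards [h.ev] with θ hθ
  rw [hs.trace φ _ _ hθ.isRep hφ hφn]

end Elliptic

section Families

open Filter Topology Real

variable {m n : ℕ} {φ : ℝ}

/-- Equality of the traces of two slopes in all the representations `IsRep` that factor through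
the Heckoid group. -/
def TraceEq (m n : ℕ) (s s' : ℚ) : Prop :=
  ∀ φ A Q, IsRep m φ A Q → sin φ ≠ 0 → sin ((2 * n : ℕ) * φ) = 0 →
    slopeTrace A Q s = slopeTrace A Q s'

lemma TraceEq.symm {s s' : ℚ} (h : TraceEq m n s s') : TraceEq m n s' s :=
  fun φ A Q hr h1 h2 => (h φ A Q hr h1 h2).symm

lemma EllipticFamily.eventuallyEq {θ₀ : ℝ} {l : Filter ℝ} {A Q : ℝ → GL (Fin 2) ℝ} {μ : ℝ → ℝ}
    (h : EllipticFamily m φ θ₀ l A Q μ) {s s' : ℚ} (ht : TraceEq m n s s') (hφ : sin φ ≠ 0)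
    (hφn : sin ((2 * n : ℕ) * φ) = 0) :
    (fun θ => slopeTrace (A θ) (Q θ) s) =ᶠ[l] fun θ => slopeTrace (A θ) (Q θ) s' :=
  h.ev.mono fun _ hθ => ht φ _ _ hθ.isRep hφ hφn

lemma prod_map_mul_const {ι : Type*} (f : ι → ℝ) (c : ℝ) (L : List ι) :
    (L.map fun i => f i * c).prod = (L.map f).prod * c ^ L.length := by
  induction L with
  | nil => simp
  | cons i L ih => simp [ih, pow_succ]; ring

lemma succ_mul_pi_div (m : ℕ) : ((m + 1 : ℕ) : ℝ) * (π / (m + 1 : ℕ)) = π :=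
  mul_div_cancel₀ _ (by positivity)

lemma mul_pi_div_succ (m : ℕ) : (m : ℝ) * (π / (m + 1 : ℕ)) = π - π / (m + 1 : ℕ) := by
  have := succ_mul_pi_div m
  push_cast at this ⊢
  linarith

lemma mul_pi_div (hm : 2 ≤ m) : (m : ℝ) * (π / m) = π :=
  mul_div_cancel₀ _ (by positivity)

lemma succ_mul_pi_div' (hm : 2 ≤ m) : ((m + 1 : ℕ) : ℝ) * (π / m) = π / m + π := by
  have := mul_pi_div hm
  push_cast
  linarith

lemma sin_pi_div_pos (hm : 2 ≤ m) : 0 < sin (π / m) := by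
  have h2 : (2 : ℝ) ≤ m := by exact_mod_cast hm
  exact sin_pos_of_pos_of_lt_pi (by positivity) (div_lt_self pi_pos (by linarith))

lemma cos_pi_div_nonneg (hm : 2 ≤ m) : 0 ≤ cos (π / m) := by
  have h2 : (2 : ℝ) ≤ m := by exact_mod_cast hm
  have h3 : 0 ≤ π / m := by positivity
  refine cos_nonneg_of_mem_Icc ⟨by linarith [pi_pos], ?_⟩
  exact div_le_div_of_nonneg_left pi_pos.le (by norm_num) h2

lemma cos_pi_div_succ_pos (hm : 2 ≤ m) : 0 < cos (π / (m + 1 : ℕ)) := by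
  have h2 : (2 : ℝ) < (m + 1 : ℕ) := by exact_mod_cast Nat.lt_succ_of_le hm
  have h3 : 0 ≤ π / (m + 1 : ℕ) := by positivity
  refine cos_pos_of_mem_Ioo ⟨by linarith [pi_pos], ?_⟩
  exact div_lt_div_of_pos_left pi_pos (by norm_num) h2

lemma exists_ellipticFamily_left (hm : 2 ≤ m) (hφ : 0 ≤ cos φ) :
    ∃ A Q μ, EllipticFamily m φ (π / (m + 1 : ℕ)) (𝓝[<] (π / (m + 1 : ℕ))) A Q μ := by
  have e1 := succ_mul_pi_div m
  have e2 := mul_pi_div_succ m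
  have hpos : 0 < π / (m + 1 : ℕ) := by positivity
  refine exists_ellipticFamily nhdsWithin_le_nhds ?_ ?_ ?_
  · have h1 : ∀ᶠ θ in 𝓝[<] (π / (m + 1 : ℕ)), 0 < sin (m * θ) := by
      refine (Continuous.tendsto (f := fun θ : ℝ => sin (m * θ)) (by fun_prop) _).mono_left
        nhdsWithin_le_nhds |>.eventually_const_lt ?_
      rw [e2, sin_pi_sub]
      exact sin_pi_div_pos (by omega)
    have h2 : ∀ᶠ θ in 𝓝[<] (π / (m + 1 : ℕ)), 0 < θ :=
      nhdsWithin_le_nhds (eventually_gt_nhds hpos)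
    filter_upwards [h1, h2, self_mem_nhdsWithin] with θ hθ1 hθ2 hθ3
    refine mul_pos hθ1 (sin_pos_of_pos_of_lt_pi (by positivity) ?_)
    have := mul_lt_mul_of_pos_left (Set.mem_Iio.1 hθ3) (by positivity : (0 : ℝ) < (m + 1 : ℕ))
    rwa [e1] at this
  · rw [e1, sin_pi, mul_zero]
  · rw [e1, e2, cos_pi_sub, cos_pi]
    linarith [cos_pi_div_succ_pos hm]

lemma exists_ellipticFamily_right (hm : 2 ≤ m) (hφ : 0 < cos φ) :
    ∃ A Q μ, EllipticFamily m φ (π / m) (𝓝[>] (π / m)) A Q μ := by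
  have e1 := succ_mul_pi_div' hm
  have e2 := mul_pi_div hm
  have hpos : 0 < π / m := by positivity
  refine exists_ellipticFamily nhdsWithin_le_nhds ?_ ?_ ?_
  · have h1 : ∀ᶠ θ in 𝓝[>] (π / m : ℝ), sin ((m + 1 : ℕ) * θ) < 0 := by
      refine (Continuous.tendsto (f := fun θ : ℝ => sin ((m + 1 : ℕ) * θ)) (by fun_prop)
        _).mono_left
        nhdsWithin_le_nhds |>.eventually_lt_const ?_
      rw [e1, sin_add_pi]
      exact neg_lt_zero.2 (sin_pi_div_pos hm)
    have h2 : ∀ᶠ θ in 𝓝[>] (π / m : ℝ), (m : ℝ) * θ < 2 * π := by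
      refine (Continuous.tendsto (f := fun θ : ℝ => (m : ℝ) * θ) (by fun_prop) _).mono_left
        nhdsWithin_le_nhds |>.eventually_lt_const ?_
      rw [e2]
      linarith [pi_pos]
    filter_upwards [h1, h2, self_mem_nhdsWithin] with θ hθ1 hθ2 hθ3
    refine mul_pos_of_neg_of_neg ?_ hθ1
    have := mul_lt_mul_of_pos_left (Set.mem_Ioi.1 hθ3) (by positivity : (0 : ℝ) < m)
    rw [e2] at this
    rw [← sin_sub_two_pi]
    exact sin_neg_of_neg_of_neg_pi_lt (by linarith) (by linarith)
  · rw [e2, sin_pi, zero_mul]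
  · rw [e1, e2, cos_add_pi, cos_pi]
    linarith [cos_pi_div_nonneg hm]

variable {A Q : ℝ → GL (Fin 2) ℝ} {μ : ℝ → ℝ} {l : Filter ℝ}

lemma EllipticFamily.tendsto_slopeTrace_near_left
    (h : EllipticFamily m φ (π / (m + 1 : ℕ)) l A Q μ) (hm : 2 ≤ m)
    (hφ : sin φ ≠ 0) (hφn : sin ((2 * n : ℕ) * φ) = 0) {s : ℚ} {ks : List ℕ}
    (hs : IsNear m n s ks) :
    Tendsto (fun θ => slopeTrace (A θ) (Q θ) s / μ θ ^ ks.length) l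
      (𝓝 ((ks.map fun k => |cheb φ (k + 1)|).prod * sin (π / (m + 1 : ℕ)) ^ ks.length)) := by
  have h1 := h.tendsto_slopeTrace_near hφ hφn hs
  have hp := sin_pi_div_pos (m := m + 1) (by omega)
  simp only [succ_mul_pi_div, mul_pi_div_succ, sin_pi, sin_pi_sub, mul_zero, List.map_const',
    List.prod_replicate, zero_pow hs.pos.ne', zero_add, abs_list_prod_map, abs_neg, abs_mul,
    prod_map_mul_const, abs_of_pos hp] at h1
  exact h1

lemma EllipticFamily.tendsto_slopeTrace_near_right (h : EllipticFamily m φ (π / m) l A Q μ)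
    (hm : 2 ≤ m) (hφ : sin φ ≠ 0) (hφn : sin ((2 * n : ℕ) * φ) = 0) {s : ℚ} {ks : List ℕ}
    (hs : IsNear m n s ks) :
    Tendsto (fun θ => slopeTrace (A θ) (Q θ) s / μ θ ^ ks.length) l
      (𝓝 ((ks.map fun k => |cheb φ k|).prod * sin (π / m) ^ ks.length)) := by
  have h1 := h.tendsto_slopeTrace_near hφ hφn hs
  have hp := sin_pi_div_pos hm
  simp only [succ_mul_pi_div' hm, mul_pi_div hm, sin_pi, sin_add_pi, mul_zero, List.map_const',
    List.prod_replicate, neg_zero, zero_pow hs.pos.ne', add_zero, abs_list_prod_map,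
    abs_mul, prod_map_mul_const, abs_pow, abs_neg, abs_of_pos hp] at h1
  exact h1

end Families

section Cheb

open Real

variable {n N : ℕ}

lemma sin_pi_div_two_mul_pos (hn : 0 < n) : 0 < sin (π / (2 * n : ℕ)) :=
  sin_pi_div_pos (by omega)

lemma sin_mul_pi_div (hn : 0 < n) : sin ((2 * n : ℕ) * (π / (2 * n : ℕ))) = 0 := by
  rw [mul_pi_div (by omega), sin_pi]

lemma cos_pi_div_two_mul_pos (hn : 2 ≤ n) : 0 < cos (π / (2 * n : ℕ)) := by
  have := cos_pi_div_succ_pos (m := 2 * n - 1) (by omega)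
  rwa [show 2 * n - 1 + 1 = 2 * n by omega] at this

lemma sin_mul_pi_div_two (n : ℕ) : sin ((2 * n : ℕ) * (π / 2)) = 0 := by
  rw [show ((2 * n : ℕ) : ℝ) * (π / 2) = n * π by push_cast; ring, sin_nat_mul_pi]

lemma cheb_pos (hN : 2 ≤ N) {k : ℕ} (h0 : 0 < k) (hk : k < N) :
    0 < cheb (π / N) k := by
  refine div_pos (sin_pos_of_pos_of_lt_pi (by positivity) ?_) (sin_pi_div_pos hN)
  have h2 := mul_pi_div hN
  have h3 : (k : ℝ) < N := by exact_mod_cast hk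
  have h4 : (0 : ℝ) < π / N := by positivity
  calc (k : ℝ) * (π / N) < N * (π / N) :=
        mul_lt_mul_of_pos_right h3 h4
    _ = π := h2

lemma cheb_zero (φ : ℝ) : cheb φ 0 = 0 := by simp [cheb]

lemma cheb_one {φ : ℝ} (h : sin φ ≠ 0) : cheb φ 1 = 1 := by simp [cheb, h]

lemma cheb_sub (hN : 2 ≤ N) {j k : ℕ} (h : j + k = N) :
    cheb (π / N) j = cheb (π / N) k := by
  have h2 := mul_pi_div hN
  have e : (j : ℝ) * (π / N) = π - k * (π / N) := by
    rw [eq_sub_iff_add_eq, ← add_mul, ← Nat.cast_add, h, h2]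
  rw [cheb, cheb, e, sin_pi_sub]

lemma cheb_succ_mul_lt (hN : 2 ≤ N) (j : ℕ) {d : ℕ} (hd : 0 < d) (hd' : d < N) :
    cheb (π / N) (j + d + 1) * cheb (π / N) j <
      cheb (π / N) (j + 1) * cheb (π / N) (j + d) := by
  set φ := π / N with hφ
  have hs : 0 < sin φ := sin_pi_div_pos hN
  have h1 : 0 < cheb φ d := cheb_pos hN hd hd'
  have h2 : 0 < sin (d * φ) := by
    have := mul_pos h1 hs
    rwa [cheb, div_mul_cancel₀ _ hs.ne'] at this
  simp only [cheb, div_mul_div_comm]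
  refine div_lt_div_of_pos_right ?_ (by positivity)
  have e1 : ((j + d + 1 : ℕ) : ℝ) * φ = j * φ + d * φ + φ := by push_cast; ring
  have e2 : ((j + 1 : ℕ) : ℝ) * φ = j * φ + φ := by push_cast; ring
  have e3 : ((j + d : ℕ) : ℝ) * φ = j * φ + d * φ := by push_cast; ring
  rw [e1, e2, e3]
  have key : sin (j * φ + φ) * sin (j * φ + d * φ) - sin (j * φ + d * φ + φ) * sin (j * φ) =
      sin φ * sin (d * φ) := by
    have h3 := sin_sq_add_cos_sq (j * φ)
    simp only [sin_add, cos_add]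
    linear_combination (sin φ * sin (d * φ)) * h3
  have := mul_pos hs h2
  linarith

lemma one_lt_cheb (hN : 2 ≤ N) {k : ℕ} (h0 : 1 < k) (hk : k < N - 1) :
    1 < cheb (π / N) k := by
  have hs : 0 < sin (π / N) := sin_pi_div_pos hN
  rw [cheb, one_lt_div hs, ← sub_pos, sin_sub_sin]
  have h2 := mul_pi_div hN
  have h3 : ((k + 1 : ℕ) : ℝ) < N := by exact_mod_cast (by omega)
  have h4 : (1 : ℝ) < k := by exact_mod_cast h0
  have h5 : (0 : ℝ) < π / N := by positivity
  have h6 := mul_lt_mul_of_pos_right h3 h5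
  have h7 := mul_lt_mul_of_pos_right h4 h5
  rw [h2, Nat.cast_add_one, add_mul, one_mul] at h6
  rw [one_mul] at h7
  have h8 : 0 < sin ((k * (π / N) - π / N) / 2) :=
    sin_pos_of_pos_of_lt_pi (by linarith) (by linarith)
  have h9 : 0 < cos ((k * (π / N) + π / N) / 2) :=
    cos_pos_of_mem_Ioo ⟨by linarith, by linarith⟩
  positivity

lemma abs_cheb_pi_div_two_add_two (k : ℕ) : |cheb (π / 2) (k + 2)| = |cheb (π / 2) k| := by
  have e : ((k + 2 : ℕ) : ℝ) * (π / 2) = k * (π / 2) + π := by push_cast; ring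
  rw [cheb, cheb, e, sin_add_pi, neg_div, abs_neg]

lemma abs_cheb_pi_div_two (k : ℕ) : |cheb (π / 2) k| = (k % 2 : ℕ) := by
  induction k using Nat.strong_induction_on with
  | _ k ih =>
    rcases k with _ | _ | k
    · simp [cheb]
    · simp [cheb]
    · rw [abs_cheb_pi_div_two_add_two, ih k (by omega)]
      congr 1
      omega

end Cheb

section Balanced

/-- Every entry of the list is at distance less than `1` from the mean. -/
def Balanced (L : List ℕ) : Prop :=
  ∀ k ∈ L, k * L.length < L.sum + L.length ∧ L.sum < k * L.length + L.length

lemma exists_prod_map_eq_pow_mul_pow {R : Type*} [CommMonoid R] (f : ℕ → R) (t : ℕ) (L : List ℕ)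
    (h : ∀ k ∈ L, k = t ∨ k = t + 1) :
    ∃ c d, c + d = L.length ∧ L.sum = t * L.length + c ∧ (L.map f).prod = f (t + 1) ^ c * f t ^ d ∧
      (c ≠ 0 → t + 1 ∈ L) ∧ (d ≠ 0 → t ∈ L) := by
  induction L with
  | nil => exact ⟨0, 0, by simp⟩
  | cons k L ih =>
    obtain ⟨c, d, h1, h2, h3, h4, h5⟩ := ih fun j hj => h j (by simp [hj])
    rcases h k (by simp) with rfl | rfl
    · refine ⟨c, d + 1, by simp [← h1, add_assoc], ?_, ?_, fun hc => by simp [h4 hc], by simp⟩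
      · rw [List.sum_cons, List.length_cons, h2]; ring
      · rw [List.map_cons, List.prod_cons, h3, pow_succ', mul_left_comm]
    · refine ⟨c + 1, d, by simp [← h1]; ring, ?_, ?_, by simp, fun hd => by simp [h5 hd]⟩
      · rw [List.sum_cons, List.length_cons, h2]; ring
      · rw [List.map_cons, List.prod_cons, h3, pow_succ', mul_assoc]

lemma prod_map_le_of_forall_le {f : ℕ → ℝ} {D : Set ℕ} (hpos : ∀ k ∈ D, 0 < f k)
    (hf : StrictAntiOn f D) : ∀ {L L' : List ℕ}, L.length = L'.length → (∀ k ∈ L, k ∈ D) →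
    (∀ k ∈ L', k ∈ D) → (∀ i ∈ L, ∀ j ∈ L', i ≤ j) → 0 < (L'.map f).prod ∧
      (L'.map f).prod ≤ (L.map f).prod ∧ (L.sum < L'.sum → (L'.map f).prod < (L.map f).prod)
  | [], [], _, _, _, _ => by simp
  | i :: L, j :: L', hlen, hD, hD', h => by
    obtain ⟨h1, h2, h3⟩ := prod_map_le_of_forall_le hpos hf (Nat.succ_injective hlen)
      (fun k hk => hD k (by simp [hk])) (fun k hk => hD' k (by simp [hk]))
      (fun i hi j hj => h i (by simp [hi]) j (by simp [hj]))
    have hi := hD i (by simp)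
    have hj := hD' j (by simp)
    have hij := h i (by simp) j (by simp)
    have hfij : f j ≤ f i := hf.antitoneOn hi hj hij
    simp only [List.map_cons, List.prod_cons, List.sum_cons]
    refine ⟨mul_pos (hpos j hj) h1, mul_le_mul hfij h2 h1.le (hpos i hi).le, fun hs => ?_⟩
    rcases hij.lt_or_eq with hlt | rfl
    · exact mul_lt_mul (hf hi hj hlt) h2 h1 (hpos i hi).le
    · exact mul_lt_mul_of_pos_left (h3 (by omega)) (hpos i hi)

lemma Balanced.eq_or_eq {L : List ℕ} (hB : Balanced L) {k : ℕ} (hk : k ∈ L) :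
    k = L.sum / L.length ∨ k = L.sum / L.length + 1 := by
  have h0 : 0 < L.length := List.length_pos_of_mem hk
  obtain ⟨h1, h2⟩ := hB k hk
  have h3 : L.sum / L.length < k + 1 := (Nat.div_lt_iff_lt_mul h0).2 (by rw [add_one_mul]; exact h2)
  have h4 : k ≤ L.sum / L.length + 1 := by
    rw [← Nat.add_div_right _ h0]
    exact (Nat.le_div_iff_mul_le h0).2 h1.le
  omega

lemma prod_map_lt_prod_map {f : ℕ → ℝ} {D : Set ℕ} (hpos : ∀ k ∈ D, 0 < f k)
    (hf : StrictAntiOn f D) {L L' : List ℕ} (hlen : L.length = L'.length)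
    (hB : Balanced L) (hB' : Balanced L') (hD : ∀ k ∈ L, k ∈ D) (hD' : ∀ k ∈ L', k ∈ D)
    (hlt : L.sum < L'.sum) : (L'.map f).prod < (L.map f).prod := by
  have hle : L.sum / L.length ≤ L'.sum / L'.length := hlen ▸ Nat.div_le_div_right hlt.le
  rcases hle.lt_or_eq with h | h
  · refine (prod_map_le_of_forall_le hpos hf hlen hD hD' fun i hi j hj => ?_).2.2 hlt
    have h1 := hB.eq_or_eq hi
    have h2 := hB'.eq_or_eq hj
    omega
  · obtain ⟨c, d, h1, h2, h3, h4, h5⟩ :=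
      exists_prod_map_eq_pow_mul_pow f _ L fun k hk => hB.eq_or_eq hk
    obtain ⟨c', d', h1', h2', h3', h4', h5'⟩ :=
      exists_prod_map_eq_pow_mul_pow f _ L' fun k hk => hB'.eq_or_eq hk
    rw [← h, ← hlen] at h2'
    rw [← h] at h3' h4'
    generalize L.sum / L.length = t at *
    have hcc : c < c' := by omega
    obtain ⟨e, rfl⟩ := Nat.exists_eq_add_of_lt hcc
    obtain rfl : d = d' + e + 1 := by omega
    have ht : t ∈ D := hD _ (h5 (by omega))
    have ht' : t + 1 ∈ D := hD' _ (h4' (by omega))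
    have hft := hf ht ht' (Nat.lt_succ_self t)
    have p1 := hpos _ ht
    have p2 := hpos _ ht'
    have := pow_lt_pow_left₀ hft p2.le (Nat.succ_ne_zero e)
    calc (L'.map f).prod = f (t + 1) ^ c * f t ^ d' * f (t + 1) ^ e.succ := by
          rw [h3', Nat.succ_eq_add_one]; ring
      _ < f (t + 1) ^ c * f t ^ d' * f t ^ e.succ := mul_lt_mul_of_pos_left this (by positivity)
      _ = (L.map f).prod := by rw [h3, Nat.succ_eq_add_one]; ring

lemma sum_eq_of_prod_map_eq {f : ℕ → ℝ} {D : Set ℕ} (hpos : ∀ k ∈ D, 0 < f k)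
    (hf : StrictAntiOn f D) {L L' : List ℕ} (hlen : L.length = L'.length)
    (hB : Balanced L) (hB' : Balanced L') (hD : ∀ k ∈ L, k ∈ D) (hD' : ∀ k ∈ L', k ∈ D)
    (h : (L.map f).prod = (L'.map f).prod) : L.sum = L'.sum := by
  rcases lt_trichotomy L.sum L'.sum with hl | hl | hl
  · exact absurd h (prod_map_lt_prod_map hpos hf hlen hB hB' hD hD' hl).ne'
  · exact hl
  · exact absurd h (prod_map_lt_prod_map hpos hf hlen.symm hB' hB hD' hD hl).ne

end Balanced

section Lead

open Filter Topology Real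

variable {m n : ℕ} {φ θ₀ x y : ℝ} {s s' : ℚ} {a b : ℕ}

/-- The trace of slope `s` is asymptotic to `x * μ ^ a` in elliptic families at `θ₀`. -/
def Lead (m : ℕ) (φ θ₀ : ℝ) (s : ℚ) (a : ℕ) (x : ℝ) : Prop :=
  ∀ l A Q μ, EllipticFamily m φ θ₀ l A Q μ →
    Tendsto (fun θ => slopeTrace (A θ) (Q θ) s / μ θ ^ a) l (𝓝 x)

/-- Elliptic families at `θ₀` exist and factor through the Heckoid group. -/
structure Admissible (m n : ℕ) (φ θ₀ : ℝ) : Prop where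
  sin_ne : sin φ ≠ 0
  sin_eq : sin ((2 * n : ℕ) * φ) = 0
  family : ∃ l A Q μ, EllipticFamily m φ θ₀ l A Q μ

lemma Admissible.order_le (h : Admissible m n φ θ₀) (ht : TraceEq m n s s')
    (h1 : Lead m φ θ₀ s a x) (hx : x ≠ 0) (h2 : Lead m φ θ₀ s' b y) : a ≤ b := by
  obtain ⟨l, A, Q, μ, hF⟩ := h.family
  have := hF.neBot
  exact Heckoid.order_le hF.atTop (hF.eventuallyEq ht h.sin_ne h.sin_eq)
    (h1 l A Q μ hF) hx (h2 l A Q μ hF)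

lemma Admissible.limit_eq (h : Admissible m n φ θ₀) (ht : TraceEq m n s s')
    (h1 : Lead m φ θ₀ s a x) (h2 : Lead m φ θ₀ s' a y) : x = y := by
  obtain ⟨l, A, Q, μ, hF⟩ := h.family
  have := hF.neBot
  exact Heckoid.limit_eq (hF.eventuallyEq ht h.sin_ne h.sin_eq)
    (h1 l A Q μ hF) (h2 l A Q μ hF)

lemma admissible_left (hm : 2 ≤ m) (hn : 2 ≤ n) :
    Admissible m n (π / (2 * n : ℕ)) (π / (m + 1 : ℕ)) :=
  ⟨(sin_pi_div_two_mul_pos (by omega)).ne', sin_mul_pi_div (by omega), _,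
    exists_ellipticFamily_left hm (cos_pi_div_two_mul_pos hn).le⟩

lemma admissible_left_pi_div_two (hm : 2 ≤ m) : Admissible m n (π / 2) (π / (m + 1 : ℕ)) :=
  ⟨by simp, sin_mul_pi_div_two n, _, exists_ellipticFamily_left hm (by simp)⟩

lemma admissible_right (hm : 2 ≤ m) (hn : 2 ≤ n) :
    Admissible m n (π / (2 * n : ℕ)) (π / m) :=
  ⟨(sin_pi_div_two_mul_pos (by omega)).ne', sin_mul_pi_div (by omega), _,
    exists_ellipticFamily_right hm (cos_pi_div_two_mul_pos hn)⟩

lemma lead_of_num_pos (hs : 0 < s.num.toNat) : Lead m φ θ₀ s (2 * s.num.toNat)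
    ((ceilDiffs (2 * s.den) (2 * s.num.toNat)).map fun k : ℕ => |sin (k * θ₀)|).prod :=
  fun _ _ _ _ h => h.tendsto_slopeTrace hs

lemma lead_near_left (hm : 2 ≤ m) (h1 : sin φ ≠ 0) (h2 : sin ((2 * n : ℕ) * φ) = 0)
    {ks : List ℕ} (hs : IsNear m n s ks) : Lead m φ (π / (m + 1 : ℕ)) s ks.length
      ((ks.map fun k => |cheb φ (k + 1)|).prod * sin (π / (m + 1 : ℕ)) ^ ks.length) :=
  fun _ _ _ _ h => h.tendsto_slopeTrace_near_left hm h1 h2 hs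

lemma lead_near_right (hm : 2 ≤ m) (h1 : sin φ ≠ 0) (h2 : sin ((2 * n : ℕ) * φ) = 0)
    {ks : List ℕ} (hs : IsNear m n s ks) : Lead m φ (π / m) s ks.length
      ((ks.map fun k => |cheb φ k|).prod * sin (π / m) ^ ks.length) :=
  fun _ _ _ _ h => h.tendsto_slopeTrace_near_right hm h1 h2 hs

end Lead

section Pairs

open Real

variable {m n : ℕ} {s s' : ℚ} {ks ks' : List ℕ}

lemma prod_map_ne_zero {ι : Type*} {f : ι → ℝ} {L : List ι} (h : ∀ i ∈ L, f i ≠ 0) :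
    (L.map f).prod ≠ 0 :=
  List.prod_ne_zero fun h0 => by
    obtain ⟨i, hi, h1⟩ := List.mem_map.1 h0
    exact h i hi h1

lemma prod_map_inv {ι : Type*} (f : ι → ℝ) (L : List ι) :
    (L.map fun i => (f i)⁻¹).prod = ((L.map f).prod)⁻¹ := by
  induction L with
  | nil => simp
  | cons i L ih => simp [ih, mul_comm]

lemma prod_map_div {ι : Type*} (f g : ι → ℝ) (L : List ι) :
    (L.map fun i => f i / g i).prod = (L.map f).prod / (L.map g).prod := by
  simp only [div_eq_mul_inv, List.prod_map_mul, prod_map_inv]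

lemma forall_ne_zero_of_prod_map {ι : Type*} {f : ι → ℝ} {L : List ι} (h : (L.map f).prod ≠ 0) :
    ∀ i ∈ L, f i ≠ 0 := fun i hi h0 =>
  h (List.prod_eq_zero (List.mem_map.2 ⟨i, hi, h0⟩))

lemma forall_eq_one_of_prod_map {ι : Type*} {f : ι → ℝ} {L : List ι} (h1 : ∀ i ∈ L, 1 ≤ f i)
    (h : (L.map f).prod = 1) : ∀ i ∈ L, f i = 1 := by
  have key : ∀ L : List ι, (∀ i ∈ L, 1 ≤ f i) → 1 ≤ (L.map f).prod := by
    intro L hL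
    induction L with
    | nil => simp
    | cons i L ih =>
      rw [List.map_cons, List.prod_cons]
      exact one_le_mul_of_one_le_of_one_le (hL i (by simp)) (ih fun j hj => hL j (by simp [hj]))
  induction L with
  | nil => simp
  | cons i L ih =>
    have h2 := h1 i (by simp)
    have h3 := key L fun j hj => h1 j (by simp [hj])
    rw [List.map_cons, List.prod_cons] at h
    have h4 : f i = 1 := by nlinarith
    rw [h4, one_mul] at h
    intro j hj
    rcases List.mem_cons.1 hj with rfl | hj
    · exact h4
    · exact ih (fun k hk => h1 k (by simp [hk])) h j hj

lemma prod_abs_cheb_ne_zero (hn : 2 ≤ n) {L : List ℕ} (h : ∀ k ∈ L, 0 < k ∧ k < 2 * n) :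
    (L.map fun k => |cheb (π / (2 * n : ℕ)) k|).prod ≠ 0 :=
  prod_map_ne_zero fun k hk => abs_ne_zero.2 (cheb_pos (by omega) (h k hk).1 (h k hk).2).ne'

lemma prod_abs_cheb_succ_ne_zero (hn : 2 ≤ n) {L : List ℕ} (h : ∀ k ∈ L, k + 1 < 2 * n) :
    (L.map fun k => |cheb (π / (2 * n : ℕ)) (k + 1)|).prod ≠ 0 :=
  prod_map_ne_zero fun k hk => abs_ne_zero.2 (cheb_pos (by omega) (by omega) (h k hk)).ne'

lemma forall_lt_of_prod_abs_cheb_succ_ne_zero (hn : 2 ≤ n) {L : List ℕ}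
    (hle : ∀ k ∈ L, k ≤ 2 * n - 1)
    (h : (L.map fun k => |cheb (π / (2 * n : ℕ)) (k + 1)|).prod ≠ 0) :
    ∀ k ∈ L, k + 1 < 2 * n := by
  intro k hk
  have h1 := forall_ne_zero_of_prod_map h k hk
  have h2 := hle k hk
  by_contra h3
  refine h1 (abs_eq_zero.2 ?_)
  rw [cheb_sub (N := 2 * n) (by omega) (k := 0) (by omega), cheb_zero]

lemma forall_pos_of_prod_abs_cheb_ne_zero {φ : ℝ} {L : List ℕ}
    (h : (L.map fun k => |cheb φ k|).prod ≠ 0) : ∀ k ∈ L, 0 < k := by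
  intro k hk
  have h1 := forall_ne_zero_of_prod_map h k hk
  by_contra h3
  obtain rfl : k = 0 := by omega
  simp [cheb_zero] at h1

lemma IsNear.le_one (hs : IsNear m n s ks) (h : 0 ∈ ks) : ∀ k ∈ ks, k ≤ 1 := by
  intro k hk
  have h1 := (hs.bounds 0 h).2
  have h2 := (hs.bounds k hk).1
  by_contra h3
  have := Nat.mul_le_mul_right ks.length (show 2 ≤ k by omega)
  omega

lemma IsNear.ge_of_mem {j : ℕ} (hs : IsNear m n s ks) (h : j + 1 ∈ ks) : ∀ k ∈ ks, j ≤ k := by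
  intro k hk
  have h1 := (hs.bounds _ h).1
  have h2 := (hs.bounds k hk).2
  by_contra h3
  have := Nat.mul_le_mul_right ks.length (show k + 1 ≤ j by omega)
  rw [add_one_mul] at this h1
  omega

lemma eq_of_near_of_near (h0 : 0 ≤ s) (h0' : 0 ≤ s') (hs : IsNear m n s ks)
    (hs' : IsNear m n s' ks') (hlen : ks.length = ks'.length) (hsum : ks.sum = ks'.sum) :
    s = s' := by
  obtain ⟨c, h1, h2, h3⟩ := hs.form
  obtain ⟨c', h1', h2', h3'⟩ := hs'.form
  rw [← hlen, ← hsum] at h3'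
  have e : s.num.toNat = s'.num.toNat ∧ c = c' := by
    generalize (2 * n - 1) * ks.length = u at h3 h3'
    generalize (2 * n - 2) * ks.length = v at h3 h3'
    omega
  exact slope_ext h0 h0' e.1 (by rw [h1, h1', e.1, e.2])

lemma near_length_le (hm : 2 ≤ m) (hn : 2 ≤ n) (ht : TraceEq m n s s') (hs : IsNear m n s ks)
    {a : ℕ} {x y : ℝ} (h1 : Lead m (π / (2 * n : ℕ)) (π / (m + 1 : ℕ)) s' a x)
    (h2 : Lead m (π / (2 * n : ℕ)) (π / m) s' a y) : ks.length ≤ a := by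
  have hL := admissible_left hm hn
  have hR := admissible_right hm hn
  by_cases hk : 0 ∈ ks
  · refine hL.order_le ht (lead_near_left hm hL.sin_ne hL.sin_eq hs) (mul_ne_zero ?_ ?_) h1
    · exact prod_abs_cheb_succ_ne_zero hn fun k hk' => by have := hs.le_one hk k hk'; omega
    · exact pow_ne_zero _ (sin_pi_div_pos (by omega)).ne'
  · refine hR.order_le ht (lead_near_right hm hR.sin_ne hR.sin_eq hs) (mul_ne_zero ?_ ?_) h2
    · refine prod_abs_cheb_ne_zero hn fun k hk' => ?_
      have := hs.le k hk'
      have : k ≠ 0 := fun h => hk (h ▸ hk')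
      omega
    · exact pow_ne_zero _ (sin_pi_div_pos (by omega)).ne'

lemma eq_near_near (hm : 2 ≤ m) (hn : 2 ≤ n) (h0 : 0 ≤ s) (h0' : 0 ≤ s') (ht : TraceEq m n s s')
    (hs : IsNear m n s ks) (hs' : IsNear m n s' ks') : s = s' := by
  have hL := admissible_left hm hn
  have hR := admissible_right hm hn
  have l1 := lead_near_left hm hL.sin_ne hL.sin_eq hs
  have l2 := lead_near_left hm hL.sin_ne hL.sin_eq hs'
  have r1 := lead_near_right hm hR.sin_ne hR.sin_eq hs
  have r2 := lead_near_right hm hR.sin_ne hR.sin_eq hs'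
  have hlen : ks.length = ks'.length :=
    le_antisymm (near_length_le hm hn ht hs l2 r2) (near_length_le hm hn ht.symm hs' l1 r1)
  refine eq_of_near_of_near h0 h0' hs hs' hlen ?_
  rw [← hlen] at l2 r2
  have pL := mul_right_cancel₀ (pow_ne_zero _ (sin_pi_div_pos (by omega)).ne')
    (hL.limit_eq ht l1 l2)
  have pR := mul_right_cancel₀ (pow_ne_zero _ (sin_pi_div_pos (by omega)).ne')
    (hR.limit_eq ht r1 r2)
  have hN : 2 ≤ 2 * n := by omega
  have hone : 1 < cheb (π / (2 * n : ℕ)) 2 := one_lt_cheb hN (by omega) (by omega)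
  have hc1 : cheb (π / (2 * n : ℕ)) 1 = 1 := cheb_one hL.sin_ne
  by_cases hk : 0 ∈ ks
  · have hks := hs.le_one hk
    have hk' : 0 ∈ ks' := by
      by_contra hk'
      refine prod_abs_cheb_ne_zero hn (L := ks') (fun k h => ?_)
        (pR ▸ List.prod_eq_zero (List.mem_map.2 ⟨0, hk, by simp [cheb_zero]⟩))
      have := hs'.le k h
      have : k ≠ 0 := fun h' => hk' (h' ▸ h)
      omega
    have hks' := hs'.le_one hk'
    refine sum_eq_of_prod_map_eq (f := fun k => |cheb (π / (2 * n : ℕ)) (k + 1)|⁻¹)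
      (D := Set.Iic 1) ?_ ?_ hlen hs.bounds hs'.bounds hks hks' ?_
    · intro k hk
      have hk : k ≤ 1 := hk
      exact inv_pos.2 (abs_pos.2 (cheb_pos hN (by omega) (by omega)).ne')
    · intro i hi j hj hij
      have hi : i ≤ 1 := hi
      have hj : j ≤ 1 := hj
      obtain rfl : i = 0 := by omega
      obtain rfl : j = 1 := by omega
      simp only [zero_add, Nat.reduceAdd, hc1, abs_one, inv_one]
      rw [abs_of_pos (by linarith)]
      exact inv_lt_one_of_one_lt₀ hone
    · rw [prod_map_inv, prod_map_inv, pL]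
  · have hks : ∀ k ∈ ks, 0 < k := fun k h => Nat.pos_of_ne_zero fun h' => hk (h' ▸ h)
    have hne : (ks.map fun k => |cheb (π / (2 * n : ℕ)) k|).prod ≠ 0 :=
      prod_abs_cheb_ne_zero hn fun k h => ⟨hks k h, by have := hs.le k h; omega⟩
    have hks' : ∀ k ∈ ks', 0 < k := forall_pos_of_prod_abs_cheb_ne_zero (pR ▸ hne)
    by_cases hk1 : 2 * n - 1 ∈ ks
    · have hk1' : 2 * n - 1 ∈ ks' := by
        by_contra hk'
        refine prod_abs_cheb_succ_ne_zero hn (L := ks') (fun k h => ?_)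
          (pL ▸ List.prod_eq_zero (List.mem_map.2 ⟨2 * n - 1, hk1, ?_⟩))
        · have := hs'.le k h
          have : k ≠ 2 * n - 1 := fun h' => hk' (h' ▸ h)
          omega
        · rw [cheb_sub hN (k := 0) (by omega), cheb_zero, abs_zero]
      refine sum_eq_of_prod_map_eq (f := fun k => |cheb (π / (2 * n : ℕ)) k|)
        (D := Set.Icc (2 * n - 2) (2 * n - 1)) ?_ ?_ hlen hs.bounds hs'.bounds
        (fun k h => ⟨?_, hs.le k h⟩) (fun k h => ⟨?_, hs'.le k h⟩) pR
      · intro k hk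
        have hk := Set.mem_Icc.1 hk
        exact abs_pos.2 (cheb_pos hN (by omega) (by omega)).ne'
      · intro i hi j hj hij
        have hi := Set.mem_Icc.1 hi
        have hj := Set.mem_Icc.1 hj
        obtain rfl : i = 2 * n - 2 := by omega
        obtain rfl : j = 2 * n - 1 := by omega
        simp only
        rw [cheb_sub hN (j := 2 * n - 2) (k := 2) (by omega),
          cheb_sub hN (j := 2 * n - 1) (k := 1) (by omega), hc1, abs_one, abs_of_pos (by linarith)]
        exact hone
      · exact hs.ge_of_mem (by rwa [show 2 * n - 2 + 1 = 2 * n - 1 by omega]) k h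
      · exact hs'.ge_of_mem (by rwa [show 2 * n - 2 + 1 = 2 * n - 1 by omega]) k h
    · have hlt : ∀ k ∈ ks, k + 1 < 2 * n := fun k h => by
        have := hs.le k h
        have : k ≠ 2 * n - 1 := fun h' => hk1 (h' ▸ h)
        omega
      have hlt' := forall_lt_of_prod_abs_cheb_succ_ne_zero hn hs'.le
        (pL ▸ prod_abs_cheb_succ_ne_zero hn hlt)
      refine sum_eq_of_prod_map_eq (f := fun k => |cheb (π / (2 * n : ℕ)) (k + 1)| /
        |cheb (π / (2 * n : ℕ)) k|) (D := Set.Icc 1 (2 * n - 2)) ?_ ?_ hlen hs.bounds hs'.bounds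
        (fun k h => ⟨hks k h, by have := hlt k h; omega⟩)
        (fun k h => ⟨hks' k h, by have := hlt' k h; omega⟩) ?_
      · intro k hk
        have hk := Set.mem_Icc.1 hk
        exact div_pos (abs_pos.2 (cheb_pos hN (by omega) (by omega)).ne')
          (abs_pos.2 (cheb_pos hN (by omega) (by omega)).ne')
      · intro i hi j hj hij
        have hi := Set.mem_Icc.1 hi
        have hj := Set.mem_Icc.1 hj
        obtain ⟨d, rfl⟩ := Nat.exists_eq_add_of_lt hij
        have p1 := cheb_pos hN (k := i) (by omega) (by omega)
        have p2 := cheb_pos hN (k := i + 1) (by omega) (by omega)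
        have p3 := cheb_pos hN (k := i + d + 1) (by omega) (by omega)
        have p4 := cheb_pos hN (k := i + d + 1 + 1) (by omega) (by omega)
        simp only
        rw [abs_of_pos p1, abs_of_pos p2, abs_of_pos p3, abs_of_pos p4, div_lt_div_iff₀ p3 p1]
        exact cheb_succ_mul_lt hN i (d := d + 1) (by omega) (by omega)
      · rw [prod_map_div, prod_map_div, pL, pR]

lemma short_bounds {l : ℕ} (h1 : s.den < m * s.num.toNat) (h2 : s.num.toNat ≤ s.den)
    (hl : l ∈ ceilDiffs (2 * s.den) (2 * s.num.toNat)) : 1 ≤ l ∧ l ≤ m := by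
  obtain ⟨h3, h4⟩ := slope_ceilDiffs_bounds hl
  constructor
  · by_contra h
    obtain rfl : l = 0 := by omega
    omega
  · by_contra h
    have := Nat.mul_le_mul_right s.num.toNat (show m + 1 ≤ l by omega)
    rw [add_one_mul] at this
    omega

lemma abs_sin_mul_ne_zero {N : ℕ} (hN : 2 ≤ N) {k : ℕ} (h0 : 0 < k) (hk : k < N) :
    |sin (k * (π / N))| ≠ 0 := by
  have h := cheb_pos hN h0 hk
  intro h1
  rw [cheb, abs_eq_zero.1 h1, zero_div] at h
  exact h.false

lemma ne_short_near (hm : 2 ≤ m) (hn : 2 ≤ n) (ht : TraceEq m n s s')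
    (h1 : s.den < m * s.num.toNat) (h2 : s.num.toNat ≤ s.den) (hs' : IsNear m n s' ks) : False := by
  have hL := admissible_left hm hn
  have hL2 := admissible_left_pi_div_two (n := n) hm
  have hR := admissible_right hm hn
  have hq : 0 < s.num.toNat := Nat.pos_of_ne_zero fun h => by simp [h] at h1
  have hN : 2 ≤ 2 * n := by omega
  have hne : ((ceilDiffs (2 * s.den) (2 * s.num.toNat)).map
      fun k : ℕ => |sin (k * (π / (m + 1 : ℕ)))|).prod ≠ 0 := prod_map_ne_zero fun l hl => by
    have := short_bounds h1 h2 hl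
    exact abs_sin_mul_ne_zero (by omega) (by omega) (by omega)
  have l1 : ∀ φ, _ := fun φ => lead_of_num_pos (m := m) (φ := φ) (θ₀ := π / (m + 1 : ℕ)) hq
  have r1 : ∀ φ, _ := fun φ => lead_of_num_pos (m := m) (φ := φ) (θ₀ := π / m) hq
  have l2 := lead_near_left hm hL.sin_ne hL.sin_eq hs'
  have l3 := lead_near_left hm hL2.sin_ne hL2.sin_eq hs'
  have r2 := lead_near_right hm hR.sin_ne hR.sin_eq hs'
  have hlen : 2 * s.num.toNat = ks.length :=
    le_antisymm (hL.order_le ht (l1 _) hne l2) (near_length_le hm hn ht.symm hs' (l1 _) (r1 _))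
  rw [← hlen] at l2 l3 r2
  have p2 := hL.limit_eq ht (l1 _) l2
  have p3 := hL2.limit_eq ht (l1 _) l3
  have q2 := hR.limit_eq ht (r1 _) r2
  have hodd : ∀ k ∈ ks, k % 2 = 0 := fun k hk => by
    have := forall_ne_zero_of_prod_map (left_ne_zero_of_mul (p3 ▸ hne)) k hk
    rw [abs_cheb_pi_div_two] at this
    have : (k + 1) % 2 ≠ 0 := by exact_mod_cast this
    omega
  have hlt := forall_lt_of_prod_abs_cheb_succ_ne_zero hn hs'.le (left_ne_zero_of_mul (p2 ▸ hne))
  by_cases hk : 0 ∈ ks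
  · have h0 : ∀ k ∈ ks, k = 0 := fun k h => by
      have := hs'.le_one hk k h
      have := hodd k h
      omega
    have hsum : ks.sum = 0 := List.sum_eq_zero h0
    obtain ⟨c, hc1, hc2, hc3⟩ := hs'.form
    have hpos := hs'.pos
    have hnl : 0 < (2 * n - 2) * ks.length := Nat.mul_pos (by omega) hpos
    rw [hsum] at hc3
    have hc : c = 0 ∧ ks.length = 2 * s'.num.toNat := by omega
    rw [hc.1, add_zero] at hc1
    have hcop := s'.reduced
    rw [hc1] at hcop
    have hnat : s'.num.natAbs = s'.num.toNat := by omega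
    rw [hnat] at hcop
    have h1' : s'.num.toNat = 1 := Nat.Coprime.eq_one_of_dvd hcop (Dvd.intro_left m rfl)
    have hq1 : s.num.toNat = 1 := by omega
    refine prod_map_ne_zero (f := fun k : ℕ => |sin (k * (π / m))|) (fun l hl => ?_)
      (q2.trans (mul_eq_zero_of_left
        (List.prod_eq_zero (List.mem_map.2 ⟨0, hk, by simp [cheb_zero]⟩)) _))
    have h3 := (slope_ceilDiffs_bounds hl).1
    have h4 := short_bounds h1 h2 hl
    rw [hq1] at h1 h3
    exact abs_sin_mul_ne_zero hm (by omega) (by omega)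
  · have hpos : ∀ k ∈ ks, 0 < k := fun k h => Nat.pos_of_ne_zero fun h' => hk (h' ▸ h)
    have hθ := sin_pi_div_pos (m := m + 1) (by omega)
    have hθ' := sin_pi_div_pos hm
    have hlen2 : (ceilDiffs (2 * s.den) (2 * s.num.toNat)).length = 2 * s.num.toNat :=
      length_ceilDiffs _ _
    have hq0 := mul_ne_zero (prod_abs_cheb_ne_zero hn fun k h =>
      ⟨hpos k h, by have := hlt k h; omega⟩) (pow_ne_zero (2 * s.num.toNat) hθ'.ne')
    have hcheb : ∀ k : ℕ, |sin (k * (π / (m + 1 : ℕ)))| =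
        |cheb (π / (m + 1 : ℕ)) k| * sin (π / (m + 1 : ℕ)) := fun k => by
      rw [cheb, abs_div, abs_of_pos hθ, div_mul_cancel₀ _ hθ.ne']
    have hone : ∀ k ∈ ks, |cheb (π / 2) (k + 1)| = 1 := fun k h => by
      have := hodd k h
      rw [abs_cheb_pi_div_two, show (k + 1) % 2 = 1 by omega, Nat.cast_one]
    have hl1 : ∀ l ∈ ceilDiffs (2 * s.den) (2 * s.num.toNat), l = 1 := by
      have p4 : ((ceilDiffs (2 * s.den) (2 * s.num.toNat)).map
          fun k => |cheb (π / (m + 1 : ℕ)) k|).prod = 1 := by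
        simp only [hcheb, prod_map_mul_const, hlen2] at p3
        rw [mul_right_cancel₀ (pow_ne_zero _ hθ.ne') p3, List.map_congr_left hone]
        simp
      have hge : ∀ l ∈ ceilDiffs (2 * s.den) (2 * s.num.toNat), l = 1 ∨ l = m ∨
          1 < |cheb (π / (m + 1 : ℕ)) l| := fun l hl => by
        have h3 := short_bounds h1 h2 hl
        by_cases h4 : l = 1
        · exact .inl h4
        by_cases h5 : l = m
        · exact .inr (.inl h5)
        exact .inr (.inr ((one_lt_cheb (by omega) (by omega) (by omega)).trans_le (le_abs_self _)))
      have hall := forall_eq_one_of_prod_map (fun l hl => ?_) p4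
      · intro l hl
        have h3 := hall l hl
        rcases hge l hl with h4 | h4 | h4
        · exact h4
        · refine absurd ?_ (forall_ne_zero_of_prod_map (q2.trans_ne hq0) l hl)
          rw [h4, mul_pi_div hm, sin_pi, abs_zero]
        · exact absurd h3 h4.ne'
      · rcases hge l hl with h4 | h4 | h4
        · rw [h4, cheb_one hθ.ne', abs_one]
        · rw [h4, cheb_sub (by omega) (show m + 1 = m + 1 from rfl), cheb_one hθ.ne', abs_one]
        · exact h4.le
    have hk2 : ∀ k ∈ ks, k = 2 * n - 2 := by
      have p4 : (ks.map fun k => |cheb (π / (2 * n : ℕ)) (k + 1)|).prod = 1 := by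
        have e : ∀ l ∈ ceilDiffs (2 * s.den) (2 * s.num.toNat),
            |cheb (π / (m + 1 : ℕ)) l| = 1 := fun l hl => by
          rw [hl1 l hl, cheb_one hθ.ne', abs_one]
        simp only [hcheb, prod_map_mul_const, hlen2] at p2
        rw [← mul_right_cancel₀ (pow_ne_zero _ hθ.ne') p2, List.map_congr_left e]
        simp
      have hge : ∀ k ∈ ks, k = 2 * n - 2 ∨ 1 < |cheb (π / (2 * n : ℕ)) (k + 1)| := fun k h => by
        have h3 := hlt k h
        have h4 := hpos k h
        by_cases h5 : k = 2 * n - 2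
        · exact .inl h5
        exact .inr ((one_lt_cheb hN (by omega) (by omega)).trans_le (le_abs_self _))
      have hall := forall_eq_one_of_prod_map (fun k h => ?_) p4
      · intro k h
        exact (hge k h).resolve_right fun h4 => h4.ne' (hall k h)
      · rcases hge k h with h4 | h4
        · rw [h4, cheb_sub hN (k := 1) (by omega), cheb_one hL.sin_ne, abs_one]
        · exact h4.le
    have p5 : (ks.map fun k => |cheb (π / (2 * n : ℕ)) k|).prod = 1 := by
      have e : ∀ l ∈ ceilDiffs (2 * s.den) (2 * s.num.toNat),
          |sin (l * (π / m))| = sin (π / m) := fun l hl => by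
        rw [hl1 l hl, Nat.cast_one, one_mul, abs_of_pos hθ']
      rw [List.map_congr_left e, List.map_const', List.prod_replicate, hlen2] at q2
      exact mul_right_cancel₀ (pow_ne_zero _ hθ'.ne') (q2.symm.trans (one_mul _).symm)
    have hgt : ∀ k ∈ ks, 1 < |cheb (π / (2 * n : ℕ)) k| := fun k h => by
      rw [hk2 k h, cheb_sub hN (k := 2) (by omega)]
      exact (one_lt_cheb hN (by omega) (by omega)).trans_le (le_abs_self _)
    obtain ⟨k, h⟩ := List.exists_mem_of_length_pos hs'.pos
    exact (hgt k h).ne' (forall_eq_one_of_prod_map (fun k h => (hgt k h).le) p5 k h)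

end Pairs

section SecondOrder

open Filter Topology Real

variable {m n : ℕ} {φ θ₀ : ℝ}

lemma prod_map_mul_comm_smul {R : Type*} [CommRing R] {ι : Type*} {T : Matrix (Fin 2) (Fin 2) R}
    {M N : ι → Matrix (Fin 2) (Fin 2) R} {c : ι → R} {L : List ι}
    (h : ∀ i ∈ L, T * M i = c i • (N i * T)) :
    T * (L.map M).prod = (L.map c).prod • ((L.map N).prod * T) := by
  induction L with
  | nil => simp
  | cons i L ih =>
    simp only [List.map_cons, List.prod_cons]
    rw [← mul_assoc, h i (by simp), smul_mul_assoc, mul_assoc (N i),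
      ih fun j hj => h j (by simp [hj]), mul_smul_comm, smul_smul, mul_assoc]

lemma trace_prod_map_eq {ι : Type*} {T : Matrix (Fin 2) (Fin 2) ℝ} (hT : IsUnit T.det)
    {M N : ι → Matrix (Fin 2) (Fin 2) ℝ} {c : ι → ℝ} {L : List ι}
    (h : ∀ i ∈ L, T * M i = c i • (N i * T)) :
    (L.map M).prod.trace = (L.map c).prod * (L.map N).prod.trace := by
  have h1 := prod_map_mul_comm_smul h
  have h2 : (L.map M).prod = T⁻¹ * (T * (L.map M).prod) := by
    rw [← mul_assoc, Matrix.nonsing_inv_mul _ hT, one_mul]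
  rw [h2, h1, Matrix.mul_smul, Matrix.trace_smul, Matrix.trace_mul_comm, mul_assoc,
    Matrix.mul_nonsing_inv _ hT, mul_one, smul_eq_mul]

lemma val_prod_map {ι : Type*} (f : ι → GL (Fin 2) ℝ) (L : List ι) :
    ((L.map f).prod).val = (L.map fun i => (f i).val).prod := by
  induction L with
  | nil => simp
  | cons i L ih => simp [ih]

lemma exists_trace_form (L : List ℕ) (hL : L ≠ []) (hθ₀ : ∀ k ∈ L, 0 < sin (k * θ₀)) :
    ∃ (E : ℝ × ℝ → ℝ) (e : ℝ), Tendsto E (𝓝 (0, θ₀)) (𝓝 e) ∧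
      ∀ (φ θ μ : ℝ) (A Q : GL (Fin 2) ℝ), IsElliptic m φ θ μ A Q → (∀ k ∈ L, 0 < sin (k * θ)) →
        absTrace (L.map fun k => A ^ k * Q).prod / μ ^ L.length =
          (L.map fun k : ℕ => sin (k * θ)).prod * |1 + (μ ^ 2)⁻¹ * E ((μ ^ 2)⁻¹, θ)| := by
  have hε : Converges (𝓝 ((0 : ℝ), θ₀)) fun x : ℝ × ℝ => x.1 :=
    ⟨_, continuous_fst.tendsto _⟩
  have hcot : ∀ k ∈ L, Converges (𝓝 ((0 : ℝ), θ₀)) fun x : ℝ × ℝ => cos (k * x.2) / sin (k * x.2) :=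
    fun k hk => by
      refine ⟨cos (k * θ₀) / sin (k * θ₀), ?_⟩
      have h1 : ContinuousAt (fun x : ℝ × ℝ => cos (k * x.2) / sin (k * x.2)) (0, θ₀) :=
        ContinuousAt.div (by fun_prop) (by fun_prop) (hθ₀ k hk).ne'
      exact h1
  obtain ⟨E, C, A, B, ⟨e, he⟩, -, -, ⟨b, hb⟩, hp⟩ := exists_prod_form hε
    (α := fun (_ : ℕ) _ => 1) (c := fun k x => -(cos (k * x.2) / sin (k * x.2)))
    (a := fun k x => cos (k * x.2) / sin (k * x.2)) (b := fun _ _ => 1) L hL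
    fun k hk => ⟨Converges.const 1, (hcot k hk).neg, hcot k hk, Converges.const 1⟩
  refine ⟨fun x => E x + B x, e + b, he.add hb, fun φ θ μ A Q h hs => ?_⟩
  have hμ := h.pos
  have h1 : (L.map fun k => (A ^ k * Q).val).prod.trace =
      (L.map fun k : ℕ => -(μ * sin (k * θ))).prod * (L.map fun k : ℕ =>
        !![1, -(cos (k * θ) / sin (k * θ)); (μ ^ 2)⁻¹ * (cos (k * θ) / sin (k * θ)),
          (μ ^ 2)⁻¹ * 1]).prod.trace := by
    refine trace_prod_map_eq (T := !![0, 1; μ⁻¹, 0]) ?_ fun k hk => ?_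
    · rw [Matrix.det_fin_two_of]
      simpa using hμ.ne'
    · have := (hs k hk).ne'
      rw [pow_mul_val_of_elliptic hμ h.A_val h.Q_val, Matrix.mul_fin_two, Matrix.mul_fin_two]
      ext i j
      fin_cases i <;> fin_cases j <;> simp <;> field_simp
  have h2 := hp ((μ ^ 2)⁻¹, θ)
  simp only at h2
  rw [absTrace, val_prod_map, h1, h2, Matrix.trace_fin_two_of, abs_mul, abs_list_prod_map]
  have h3 : ∀ k ∈ L, |-(μ * sin (k * θ))| = sin (k * θ) * μ := fun k hk => by
    rw [abs_neg, abs_mul, abs_of_pos hμ, abs_of_pos (hs k hk), mul_comm]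
  rw [List.map_congr_left h3, prod_map_mul_const]
  simp only [List.map_const', List.prod_replicate, one_pow]
  rw [mul_right_comm, mul_div_assoc, div_self (by positivity), mul_one]
  congr 2
  ring

lemma hasDerivAt_list_prod {ι : Type*} {f : ι → ℝ → ℝ} {d : ι → ℝ} {x : ℝ} {L : List ι}
    (h : ∀ i ∈ L, HasDerivAt (f i) (f i x * d i) x) :
    HasDerivAt (fun y => (L.map fun i => f i y).prod)
      ((L.map fun i => f i x).prod * (L.map d).sum) x := by
  induction L with
  | nil => simpa using hasDerivAt_const x (1 : ℝ)
  | cons i L ih =>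
    simp only [List.map_cons, List.prod_cons, List.sum_cons]
    refine ((h i (by simp)).mul (ih fun j hj => h j (by simp [hj]))).congr_deriv ?_
    ring

/-- The inverse square of the parameter vanishes to first order at `π / (m + 1)`. -/
lemma EllipticFamily.tendsto_inv_sq_div (hm : 2 ≤ m) (hφ : 0 ≤ cos φ) {A Q : ℝ → GL (Fin 2) ℝ}
    {μ : ℝ → ℝ} (h : EllipticFamily m φ (π / (m + 1 : ℕ)) (𝓝[<] (π / (m + 1 : ℕ))) A Q μ) :
    Tendsto (fun θ => (μ θ ^ 2)⁻¹ / (θ - π / (m + 1 : ℕ))) (𝓝[<] (π / (m + 1 : ℕ)))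
      (𝓝 (-(sin (π / (m + 1 : ℕ)) * (m + 1 : ℕ)) / (2 * cos φ + 2 * cos (π / (m + 1 : ℕ))))) := by
  set θ₀ := π / (m + 1 : ℕ) with hθ₀
  have hNpos : 0 < 2 * cos φ + 2 * cos θ₀ := by linarith [cos_pi_div_succ_pos hm]
  have hN := h.tendsto_continuous
    (f := fun θ => 2 * cos φ + 2 * (cos (m * θ) * cos ((m + 1 : ℕ) * θ))) (by fun_prop)
  have hs := h.tendsto_continuous (f := fun θ => sin (m * θ)) (by fun_prop)
  have e1 : ((m + 1 : ℕ) : ℝ) * θ₀ = π := succ_mul_pi_div m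
  have e2 : (m : ℝ) * θ₀ = π - θ₀ := mul_pi_div_succ m
  rw [e1, e2, cos_pi_sub, cos_pi, neg_mul_neg, mul_one] at hN
  rw [e2, sin_pi_sub] at hs
  have hε : Tendsto (fun θ => (μ θ ^ 2)⁻¹) (𝓝[<] θ₀) (𝓝 0) := by
    simpa using h.inv_tendsto.pow 2
  have hd : HasDerivAt (fun θ : ℝ => sin ((m + 1 : ℕ) * θ)) (-(m + 1 : ℕ)) θ₀ := by
    have := ((hasDerivAt_id θ₀).const_mul ((m + 1 : ℕ) : ℝ)).sin
    simpa [e1, -Nat.cast_add] using this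
  have hsl := (hasDerivAt_iff_tendsto_slope.1 hd).mono_left
    (nhdsWithin_mono θ₀ fun θ hθ => ne_of_lt hθ : 𝓝[<] θ₀ ≤ 𝓝[≠] θ₀)
  have hlim := ((hs.mul hsl).mul ((hε.pow 2).const_add 1)).div hN hNpos.ne'
  have e3 : sin θ₀ * -((m + 1 : ℕ) : ℝ) * (1 + 0 ^ 2) / (2 * cos φ + 2 * cos θ₀) =
      -(sin θ₀ * (m + 1 : ℕ)) / (2 * cos φ + 2 * cos θ₀) := by ring
  rw [e3] at hlim
  refine hlim.congr' ?_
  filter_upwards [h.ev, hN.eventually_const_lt hNpos, self_mem_nhdsWithin] with θ hθ hθN hlt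
  have hrel := hθ.rel
  have hμ := hθ.pos
  have hne : θ - θ₀ ≠ 0 := sub_ne_zero.2 (ne_of_lt hlt)
  simp only [Pi.div_apply, slope_def_field]
  rw [e1, sin_pi, sub_zero, div_eq_div_iff hθN.ne' hne, ← hrel]
  field_simp

end SecondOrder

section Short

open Filter Topology Real

variable {m n : ℕ} {φ θ₀ : ℝ} {s s' : ℚ}

lemma strictAntiOn_mul_cot : StrictAntiOn (fun x => x * (cos x / sin x)) (Set.Ioo 0 π) := by
  have hd : ∀ x ∈ Set.Ioo 0 π, HasDerivAt (fun x => x * (cos x / sin x))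
      (1 * (cos x / sin x) + x * ((-sin x * sin x - cos x * cos x) / sin x ^ 2)) x :=
    fun x hx => (hasDerivAt_id x).mul
      ((hasDerivAt_cos x).div (hasDerivAt_sin x) (sin_pos_of_mem_Ioo hx).ne')
  refine strictAntiOn_of_deriv_neg (convex_Ioo 0 π)
    (fun x hx => (hd x hx).continuousAt.continuousWithinAt) fun x hx => ?_
  rw [interior_Ioo] at hx
  rw [(hd x hx).deriv]
  have hs := sin_pos_of_mem_Ioo hx
  have h1 : sin x * cos x < x := by
    have h2 : sin (2 * x) < 2 * x := sin_lt (by linarith [hx.1])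
    rw [sin_two_mul] at h2
    linarith
  have h3 := sin_sq_add_cos_sq x
  have e : 1 * (cos x / sin x) + x * ((-sin x * sin x - cos x * cos x) / sin x ^ 2) =
      (sin x * cos x - x) / sin x ^ 2 := by
    field_simp
    linear_combination (-x) * h3
  rw [e]
  exact div_neg_of_neg_of_pos (by linarith) (by positivity)

lemma mul_cot_prod_relation (hm : 2 ≤ m) (hφ : 0 ≤ cos φ) {A Q : ℝ → GL (Fin 2) ℝ} {μ : ℝ → ℝ}
    (h : EllipticFamily m φ (π / (m + 1 : ℕ)) (𝓝[<] (π / (m + 1 : ℕ))) A Q μ) {L L' : List ℕ}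
    (hlen : L.length = L'.length) (hθ₀ : θ₀ = π / (m + 1 : ℕ))
    (hL : ∀ k ∈ L, 0 < sin (k * θ₀)) (hL' : ∀ k ∈ L', 0 < sin (k * θ₀))
    (hprod : (L.map fun k : ℕ => sin (k * θ₀)).prod = (L'.map fun k : ℕ => sin (k * θ₀)).prod)
    (heq : ∀ᶠ θ in 𝓝[<] θ₀, absTrace (L.map fun k => A θ ^ k * Q θ).prod =
      absTrace (L'.map fun k => A θ ^ k * Q θ).prod)
    {E E' : ℝ × ℝ → ℝ} {e e' : ℝ} (hE : Tendsto E (𝓝 (0, θ₀)) (𝓝 e))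
    (hE' : Tendsto E' (𝓝 (0, θ₀)) (𝓝 e'))
    (hf : ∀ (θ μ : ℝ) (A Q : GL (Fin 2) ℝ), IsElliptic m φ θ μ A Q → (∀ k ∈ L, 0 < sin (k * θ)) →
      absTrace (L.map fun k => A ^ k * Q).prod / μ ^ L.length =
        (L.map fun k : ℕ => sin (k * θ)).prod * |1 + (μ ^ 2)⁻¹ * E ((μ ^ 2)⁻¹, θ)|)
    (hf' : ∀ (θ μ : ℝ) (A Q : GL (Fin 2) ℝ), IsElliptic m φ θ μ A Q →
      (∀ k ∈ L', 0 < sin (k * θ)) → absTrace (L'.map fun k => A ^ k * Q).prod / μ ^ L'.length =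
        (L'.map fun k : ℕ => sin (k * θ)).prod * |1 + (μ ^ 2)⁻¹ * E' ((μ ^ 2)⁻¹, θ)|) :
    (2 * cos φ + 2 * cos θ₀) * ((L.map fun k : ℕ => k * (cos (k * θ₀) / sin (k * θ₀))).sum -
      (L'.map fun k : ℕ => k * (cos (k * θ₀) / sin (k * θ₀))).sum) =
      -(sin θ₀ * (m + 1 : ℕ)) * (e' - e) := by
  have hκ := h.tendsto_inv_sq_div hm hφ
  rw [← hθ₀] at h hκ
  have hNpos : 0 < 2 * cos φ + 2 * cos θ₀ := by
    have := cos_pi_div_succ_pos hm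
    rw [← hθ₀] at this
    linarith
  have hle : 𝓝[<] θ₀ ≤ 𝓝[≠] θ₀ := nhdsWithin_mono θ₀ fun θ hθ => ne_of_lt hθ
  have hd : ∀ L : List ℕ, (∀ k ∈ L, 0 < sin (k * θ₀)) →
      HasDerivAt (fun θ : ℝ => (L.map fun k : ℕ => sin (k * θ)).prod)
        ((L.map fun k : ℕ => sin (k * θ₀)).prod *
          (L.map fun k : ℕ => k * (cos (k * θ₀) / sin (k * θ₀))).sum) θ₀ := by
    intro L hL
    refine hasDerivAt_list_prod (f := fun (k : ℕ) θ => sin (k * θ)) fun k hk => ?_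
    have h1 := ((hasDerivAt_id θ₀).const_mul (k : ℝ)).sin
    refine h1.congr_deriv ?_
    have := (hL k hk).ne'
    simp only [id]
    field_simp
  have hsl := ((hasDerivAt_iff_tendsto_slope.1 ((hd L hL).sub (hd L' hL')))).mono_left hle
  have hpos : ∀ L : List ℕ, (∀ k ∈ L, 0 < sin (k * θ₀)) →
      ∀ᶠ θ in 𝓝[<] θ₀, ∀ k ∈ L, 0 < sin (k * θ) := by
    intro L hL
    have : ∀ᶠ θ in 𝓝[<] θ₀, ∀ k ∈ L.toFinset, 0 < sin (k * θ) := by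
      rw [Filter.eventually_all_finset]
      intro k hk
      exact (h.tendsto_continuous (f := fun θ => sin (k * θ)) (by fun_prop)).eventually_const_lt
        (hL k (List.mem_toFinset.1 hk))
    simpa using this
  have hε : Tendsto (fun θ => (μ θ ^ 2)⁻¹) (𝓝[<] θ₀) (𝓝 0) := by
    simpa using h.inv_tendsto.pow 2
  have hpair : Tendsto (fun θ => ((μ θ ^ 2)⁻¹, θ)) (𝓝[<] θ₀) (𝓝 (0, θ₀)) :=
    hε.prodMk_nhds h.le_nhds
  have t1 := hE.comp hpair
  have t2 := hE'.comp hpair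
  have hone : ∀ {E : ℝ × ℝ → ℝ} {e : ℝ},
      Tendsto (fun θ => E ((μ θ ^ 2)⁻¹, θ)) (𝓝[<] θ₀) (𝓝 e) →
      ∀ᶠ θ in 𝓝[<] θ₀, 0 < 1 + (μ θ ^ 2)⁻¹ * E ((μ θ ^ 2)⁻¹, θ) := by
    intro E e hE
    have := (hε.mul hE).const_add 1
    rw [zero_mul, add_zero] at this
    exact this.eventually_const_lt one_pos
  have hG : ∀ L : List ℕ, (∀ k ∈ L, 0 < sin (k * θ₀)) →
      Tendsto (fun θ : ℝ => (L.map fun k : ℕ => sin (k * θ)).prod) (𝓝[<] θ₀)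
        (𝓝 (L.map fun k : ℕ => sin (k * θ₀)).prod) := fun L hL =>
    (hd L hL).continuousAt.tendsto.mono_left h.le_nhds
  have hlim := hκ.mul (((hG L' hL').mul t2).sub ((hG L hL).mul t1))
  have key := tendsto_nhds_unique hsl (hlim.congr' ?_)
  · have hF : (L'.map fun k : ℕ => sin (k * θ₀)).prod ≠ 0 :=
      prod_map_ne_zero fun k hk => (hL' k hk).ne'
    rw [hprod, div_mul_eq_mul_div, eq_div_iff hNpos.ne'] at key
    apply mul_left_cancel₀ hF
    linear_combination key
  · filter_upwards [h.ev, heq, hpos L hL, hpos L' hL', hone t1, hone t2,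
      self_mem_nhdsWithin] with θ hθ heqθ hp hp' h1 h1' hlt
    have r1 := hf θ _ _ _ hθ hp
    have r2 := hf' θ _ _ _ hθ hp'
    rw [heqθ, hlen, r2, abs_of_pos h1, abs_of_pos h1'] at r1
    have hne : θ - θ₀ ≠ 0 := sub_ne_zero.2 (ne_of_lt hlt)
    simp only [slope_def_field, Pi.sub_apply, Function.comp_apply]
    rw [hprod, sub_self, sub_zero, div_mul_eq_mul_div]
    congr 1
    linear_combination r1

lemma eq_short_short (hm : 2 ≤ m) (hn : 2 ≤ n) (h0 : 0 ≤ s) (h0' : 0 ≤ s') (ht : TraceEq m n s s')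
    (h1 : s.den < m * s.num.toNat) (h2 : s.num.toNat ≤ s.den)
    (h1' : s'.den < m * s'.num.toNat) (h2' : s'.num.toNat ≤ s'.den) : s = s' := by
  have hL := admissible_left hm hn
  have hq : 0 < s.num.toNat := Nat.pos_of_ne_zero fun h => by simp [h] at h1
  have hq' : 0 < s'.num.toNat := Nat.pos_of_ne_zero fun h => by simp [h] at h1'
  have hsin : ∀ k : ℕ, 1 ≤ k ∧ k ≤ m → 0 < sin (k * (π / (m + 1 : ℕ))) := fun k hk => by
    have := cheb_pos (N := m + 1) (by omega) (k := k) (by omega) (by omega)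
    have h3 := mul_pos this (sin_pi_div_pos (m := m + 1) (by omega))
    rwa [cheb, div_mul_cancel₀ _ (sin_pi_div_pos (m := m + 1) (by omega)).ne'] at h3
  have hb := fun k (hk : k ∈ ceilDiffs (2 * s.den) (2 * s.num.toNat)) =>
    hsin k (short_bounds h1 h2 hk)
  have hb' := fun k (hk : k ∈ ceilDiffs (2 * s'.den) (2 * s'.num.toNat)) =>
    hsin k (short_bounds h1' h2' hk)
  have l1 := lead_of_num_pos (m := m) (φ := π / (2 * n : ℕ)) (θ₀ := π / (m + 1 : ℕ)) hq
  have l1' := lead_of_num_pos (m := m) (φ := π / (2 * n : ℕ)) (θ₀ := π / (m + 1 : ℕ)) hq'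
  have hqq : 2 * s.num.toNat = 2 * s'.num.toNat :=
    le_antisymm (hL.order_le ht l1 (prod_map_ne_zero fun k hk => (abs_pos.2 (hb k hk).ne').ne') l1')
      (hL.order_le ht.symm l1' (prod_map_ne_zero fun k hk => (abs_pos.2 (hb' k hk).ne').ne') l1)
  have hprod := hL.limit_eq ht (x := ((ceilDiffs (2 * s.den) (2 * s.num.toNat)).map
    fun k : ℕ => |sin (k * (π / (m + 1 : ℕ)))|).prod) (by rw [← hqq]; exact l1) l1'
  rw [List.map_congr_left fun k hk => abs_of_pos (hb k hk),
    List.map_congr_left fun k hk => abs_of_pos (hb' k hk)] at hprod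
  have hlen : (ceilDiffs (2 * s.den) (2 * s.num.toNat)).length =
      (ceilDiffs (2 * s'.den) (2 * s'.num.toNat)).length := by simpa using hqq
  have hne : ∀ u {v : ℕ}, 0 < v → ceilDiffs u (2 * v) ≠ [] := fun u v hv h => by
    have := length_ceilDiffs u (2 * v)
    rw [h, List.length_nil] at this
    omega
  obtain ⟨E, e, hE, hf⟩ := exists_trace_form (m := m) _ (hne (2 * s.den) hq) hb
  obtain ⟨E', e', hE', hf'⟩ := exists_trace_form (m := m) _ (hne (2 * s'.den) hq') hb'
  let D (L : List ℕ) : ℝ := (L.map fun k : ℕ =>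
    k * (cos (k * (π / (m + 1 : ℕ))) / sin (k * (π / (m + 1 : ℕ))))).sum
  have rel : ∀ φ : ℝ, 0 ≤ cos φ → sin φ ≠ 0 → sin ((2 * n : ℕ) * φ) = 0 →
      (2 * cos φ + 2 * cos (π / (m + 1 : ℕ))) * (D (ceilDiffs (2 * s.den) (2 * s.num.toNat)) -
        D (ceilDiffs (2 * s'.den) (2 * s'.num.toNat))) =
      -(sin (π / (m + 1 : ℕ)) * (m + 1 : ℕ)) * (e' - e) :=
    fun φ hc hs hsn => by
      obtain ⟨A, Q, μ, hF⟩ := exists_ellipticFamily_left hm hc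
      have heq := hF.eventuallyEq ht hs hsn
      simp only [slopeTrace_eq_ceilDiffs _ _ hq, slopeTrace_eq_ceilDiffs _ _ hq'] at heq
      exact mul_cot_prod_relation hm hc hF hlen rfl hb hb' hprod heq hE hE' (hf φ) (hf' φ)
  have rel1 := rel _ (cos_pi_div_two_mul_pos hn).le hL.sin_ne hL.sin_eq
  have rel2 := rel (π / 2) (by simp) (by simp) (sin_mul_pi_div_two n)
  rw [cos_pi_div_two, ← rel1] at rel2
  have hD : D (ceilDiffs (2 * s.den) (2 * s.num.toNat)) =
      D (ceilDiffs (2 * s'.den) (2 * s'.num.toNat)) := by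
    refine sub_eq_zero.1 (mul_left_cancel₀ (cos_pi_div_two_mul_pos hn).ne' ?_)
    linear_combination (-1 / 2) * rel2
  have hbal : ∀ u {v : ℕ}, 0 < v → Balanced (ceilDiffs u (2 * v)) := fun u v hv k hk => by
    rw [length_ceilDiffs, sum_ceilDiffs _ (by omega)]
    exact ceilDiffs_bounds hk
  have hsum := sum_eq_of_prod_map_eq
    (f := fun k : ℕ => exp (k * (cos (k * (π / (m + 1 : ℕ))) / sin (k * (π / (m + 1 : ℕ))))))
    (D := Set.Icc 1 m) (fun k _ => exp_pos _) ?_ hlen (hbal _ hq) (hbal _ hq')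
    (fun k hk => short_bounds h1 h2 hk) (fun k hk => short_bounds h1' h2' hk) ?_
  · rw [sum_ceilDiffs _ (by omega), sum_ceilDiffs _ (by omega)] at hsum
    exact slope_ext h0 h0' (by omega) (by omega)
  · intro i hi j hj hij
    have hθ₀ : 0 < π / (m + 1 : ℕ) := by positivity
    have hmem : ∀ k ∈ Set.Icc 1 m, k * (π / (m + 1 : ℕ)) ∈ Set.Ioo 0 π := fun k hk => by
      have h3 : (0 : ℝ) < k := by exact_mod_cast hk.1
      have h4 : (k : ℝ) < (m + 1 : ℕ) := by exact_mod_cast Nat.lt_succ_of_le hk.2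
      exact ⟨by positivity, (mul_lt_mul_of_pos_right h4 hθ₀).trans_eq (succ_mul_pi_div m)⟩
    have := strictAntiOn_mul_cot (hmem i hi) (hmem j hj)
      (mul_lt_mul_of_pos_right (by exact_mod_cast hij) hθ₀)
    refine exp_lt_exp.2 (lt_of_mul_lt_mul_left ?_ hθ₀.le)
    simp only at this
    linarith
  · have hexp : ∀ L : List ℕ, ∀ f : ℕ → ℝ, (L.map fun k => exp (f k)).prod = exp (L.map f).sum :=
      fun L f => by rw [exp_list_sum, List.map_map]; rfl
    rw [hexp, hexp]
    exact congrArg exp hD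

end Short

section Hyperbolic

open Filter Topology Real

variable {m n : ℕ} {φ : ℝ}

/-- The square of the off-diagonal parameter of the hyperbolic family. -/
noncomputable def hypSq (m : ℕ) (φ x : ℝ) : ℝ :=
  (1 + 2 * cos φ * x + x ^ 2) / ((1 - x ^ (2 * m)) * (1 - x ^ (2 * m + 2)))

/-- A representation sending `a` to a diagonal matrix. -/
structure IsHyperbolic (m : ℕ) (φ x y : ℝ) (A Q : GL (Fin 2) ℝ) : Prop where
  isRep : IsRep m φ A Q
  pos : 0 < x
  A_val : A.val = !![x⁻¹, 0; 0, x]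
  Q_val : Q.val = !![y * x ^ m, x ^ m; -((1 + y ^ 2 * x ^ (2 * m)) / x ^ m), -(y * x ^ m)]

lemma pow_mul_val_of_hyperbolic {x y : ℝ} {A Q : GL (Fin 2) ℝ} (hA : A.val = !![x⁻¹, 0; 0, x])
    (hQ : Q.val = !![y * x ^ m, x ^ m; -((1 + y ^ 2 * x ^ (2 * m)) / x ^ m), -(y * x ^ m)])
    (k : ℕ) : (A ^ k * Q).val = !![y * x ^ m / x ^ k, x ^ m / x ^ k;
      -(x ^ k * ((1 + y ^ 2 * x ^ (2 * m)) / x ^ m)), -(y * x ^ m * x ^ k)] := by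
  have h : (A ^ k).val = !![(x ^ k)⁻¹, 0; 0, x ^ k] := by
    induction k with
    | zero => simp [Matrix.one_fin_two]
    | succ k ih =>
      rw [pow_succ, Units.val_mul, ih, hA, Matrix.mul_fin_two]
      ext i j
      fin_cases i <;> fin_cases j <;> simp [pow_succ, mul_comm]
  rw [Units.val_mul, h, hQ, Matrix.mul_fin_two]
  ext i j
  fin_cases i <;> fin_cases j <;> simp <;> ring

lemma exists_isHyperbolic (hm : m ≠ 0) (hφ : 0 ≤ cos φ) {x : ℝ} (hx : 0 < x) (hx1 : x < 1) :
    ∃ p : GL (Fin 2) ℝ × GL (Fin 2) ℝ, IsHyperbolic m φ x √(hypSq m φ x) p.1 p.2 := by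
  have hu : 0 < x ^ m := pow_pos hx m
  have h1 : 0 < 1 - x ^ (2 * m) := sub_pos.2 (pow_lt_one₀ hx.le hx1 (by omega))
  have h2 : 0 < 1 - x ^ (2 * m + 2) := sub_pos.2 (pow_lt_one₀ hx.le hx1 (by omega))
  have hg : √(hypSq m φ x) ^ 2 * ((1 - x ^ (2 * m)) * (1 - x ^ (2 * m + 2))) =
      1 + 2 * cos φ * x + x ^ 2 := by
    rw [sq_sqrt (by rw [hypSq]; positivity), hypSq, div_mul_cancel₀ _ (by positivity)]
  generalize √(hypSq m φ x) = y at hg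
  obtain ⟨r, hr, hr2⟩ : ∃ r : ℝ, 0 < r ∧ r ^ 2 = 1 + y ^ 2 * x ^ (2 * m) :=
    ⟨√(1 + y ^ 2 * x ^ (2 * m)), sqrt_pos.2 (by positivity), sq_sqrt (by positivity)⟩
  have e1 : x ^ (2 * m) = (x ^ m) ^ 2 := by rw [mul_comm, pow_mul]
  let A : GL (Fin 2) ℝ := ⟨!![x⁻¹, 0; 0, x], !![x, 0; 0, x⁻¹],
    by simp [Matrix.one_fin_two, hx.ne'], by simp [Matrix.one_fin_two, hx.ne']⟩
  let Q : GL (Fin 2) ℝ :=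
    ⟨!![y * x ^ m, x ^ m; -((1 + y ^ 2 * x ^ (2 * m)) / x ^ m), -(y * x ^ m)],
    !![-(y * x ^ m), -x ^ m; (1 + y ^ 2 * x ^ (2 * m)) / x ^ m, y * x ^ m],
    by
      rw [Matrix.mul_fin_two, Matrix.one_fin_two, e1]
      ext i j
      fin_cases i <;> fin_cases j <;> simp <;> field_simp <;> ring,
    by
      rw [Matrix.mul_fin_two, Matrix.one_fin_two, e1]
      ext i j
      fin_cases i <;> fin_cases j <;> simp <;> field_simp <;> ring⟩
  let W₀ : Matrix (Fin 2) (Fin 2) ℝ :=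
    !![r, y * (x ^ m) ^ 2 / r; -(y * r), -r]
  have hW : W₀ * W₀ = 1 := by
    rw [Matrix.mul_fin_two, Matrix.one_fin_two]
    rw [e1] at hr2
    ext i j
    fin_cases i <;> fin_cases j <;> simp <;> field_simp <;> linarith
  let W : GL (Fin 2) ℝ := ⟨W₀, W₀, hW, hW⟩
  refine ⟨(A, Q), ⟨?_, ?_, ?_, ⟨W, ?_, ?_⟩, ?_⟩, hx, rfl, rfl⟩
  · change Matrix.det !![x⁻¹, 0; 0, x] = 1
    rw [Matrix.det_fin_two_of]
    field_simp
    ring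
  · change Matrix.det !![y * x ^ m, x ^ m; -((1 + y ^ 2 * x ^ (2 * m)) / x ^ m), -(y * x ^ m)] = 1
    rw [Matrix.det_fin_two_of, e1]
    field_simp
    ring
  · apply Units.ext
    change !![y * x ^ m, x ^ m; -((1 + y ^ 2 * x ^ (2 * m)) / x ^ m), -(y * x ^ m)] *
      !![y * x ^ m, x ^ m; -((1 + y ^ 2 * x ^ (2 * m)) / x ^ m), -(y * x ^ m)] = -1
    rw [Matrix.mul_fin_two, Matrix.one_fin_two, e1]
    ext i j
    fin_cases i <;> fin_cases j <;> simp <;> field_simp <;> ring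
  · exact Units.ext hW
  · apply Units.ext
    change W₀ * !![x, 0; 0, x⁻¹] * W₀ =
      !![y * x ^ m, x ^ m; -((1 + y ^ 2 * x ^ (2 * m)) / x ^ m), -(y * x ^ m)] *
      !![x⁻¹, 0; 0, x] *
      !![-(y * x ^ m), -x ^ m; (1 + y ^ 2 * x ^ (2 * m)) / x ^ m, y * x ^ m]
    rw [← hr2]
    simp only [W₀, Matrix.mul_fin_two]
    ext i j
    fin_cases i <;> fin_cases j <;> simp <;> field_simp <;> ring
  · rw [Units.val_mul, pow_mul_val_of_hyperbolic rfl rfl, pow_mul_val_of_hyperbolic rfl rfl,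
      Matrix.mul_fin_two, Matrix.trace_fin_two]
    simp only [Matrix.of_apply, Matrix.cons_val', Matrix.cons_val_zero, Matrix.cons_val_one,
      Matrix.cons_val_fin_one]
    rw [pow_add, e1] at hg
    rw [e1, pow_succ]
    field_simp
    linear_combination hg

/-- A family of hyperbolic representations degenerating as `x → 0`. -/
def HyperbolicFamily (m : ℕ) (φ : ℝ) (A Q : ℝ → GL (Fin 2) ℝ) : Prop :=
  ∀ᶠ x in 𝓝[>] (0 : ℝ), IsHyperbolic m φ x √(hypSq m φ x) (A x) (Q x)

lemma exists_hyperbolicFamily (hm : m ≠ 0) (hφ : 0 ≤ cos φ) :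
    ∃ A Q, HyperbolicFamily m φ A Q := by
  have hex : ∀ᶠ x in 𝓝[>] (0 : ℝ), ∃ p : GL (Fin 2) ℝ × GL (Fin 2) ℝ,
      IsHyperbolic m φ x √(hypSq m φ x) p.1 p.2 := by
    filter_upwards [Ioo_mem_nhdsGT one_pos] with x hx
    exact exists_isHyperbolic hm hφ hx.1 hx.2
  obtain ⟨f, hf⟩ := hex.choice
  exact ⟨fun x => (f x).1, fun x => (f x).2, hf⟩

lemma hypSq_zero (hm : m ≠ 0) : hypSq m φ 0 = 1 := by simp [hypSq, hm]

lemma hasDerivAt_hypSq (hm : 2 ≤ m) : HasDerivAt (hypSq m φ) (2 * cos φ) 0 := by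
  have h1 : HasDerivAt (fun x : ℝ => 1 + 2 * cos φ * x + x ^ 2) (2 * cos φ) 0 := by
    have := (((hasDerivAt_id (0 : ℝ)).const_mul (2 * cos φ)).const_add 1).add
      (hasDerivAt_pow 2 (0 : ℝ))
    exact this.congr_deriv (by simp)
  have h2 : ∀ k : ℕ, 2 ≤ k → HasDerivAt (fun x : ℝ => 1 - x ^ k) 0 0 := fun k hk => by
    have := (hasDerivAt_pow k (0 : ℝ)).const_sub 1
    simpa [show k - 1 ≠ 0 by omega] using this
  have h3 := h1.div ((h2 (2 * m) (by omega)).mul (h2 (2 * m + 2) (by omega)))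
    (by simp [show m ≠ 0 by omega])
  refine h3.congr_deriv ?_
  simp [show m ≠ 0 by omega]

lemma tendsto_hypSq (hm : 2 ≤ m) : Tendsto (hypSq m φ) (𝓝[>] 0) (𝓝 1) := by
  have := (hasDerivAt_hypSq (φ := φ) hm).continuousAt.tendsto
  rw [hypSq_zero (by omega)] at this
  exact this.mono_left nhdsWithin_le_nhds

lemma tendsto_inv_atTop_nhdsGT : Tendsto (fun x : ℝ => x⁻¹) (𝓝[>] 0) atTop :=
  tendsto_inv_nhdsGT_zero

lemma converges_pow (k : ℕ) : Converges (𝓝[>] (0 : ℝ)) fun x => x ^ k :=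
  ⟨_, ((continuous_pow k).tendsto 0).mono_left nhdsWithin_le_nhds⟩

lemma converges_sqrt_hypSq (hm : 2 ≤ m) : Converges (𝓝[>] (0 : ℝ)) fun x => √(hypSq m φ x) :=
  ⟨_, (tendsto_hypSq hm).sqrt⟩

lemma HyperbolicFamily.eventuallyEq {A Q : ℝ → GL (Fin 2) ℝ} (h : HyperbolicFamily m φ A Q)
    {s s' : ℚ} (ht : TraceEq m n s s') (hφ : sin φ ≠ 0) (hφn : sin ((2 * n : ℕ) * φ) = 0) :
    (fun x => slopeTrace (A x) (Q x) s) =ᶠ[𝓝[>] 0] fun x => slopeTrace (A x) (Q x) s' :=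
  h.mono fun _ hx => ht φ _ _ hx.isRep hφ hφn

/-- The trace of slope `s` has order at most `a` in hyperbolic families. -/
def HypOrderLE (m : ℕ) (φ : ℝ) (s : ℚ) (a : ℕ) : Prop :=
  ∀ A Q, HyperbolicFamily m φ A Q →
    ∃ y, Tendsto (fun x => slopeTrace (A x) (Q x) s / x⁻¹ ^ a) (𝓝[>] 0) (𝓝 y)

lemma hypOrderLE_short (hm : 2 ≤ m) {s : ℚ} (h1 : s.den < m * s.num.toNat)
    (h2 : s.num.toNat ≤ s.den) : HypOrderLE m φ s (2 * s.num.toNat) := by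
  intro A Q hF
  have hq : 0 < s.num.toNat := Nat.pos_of_ne_zero fun h => by simp [h] at h1
  set L := ceilDiffs (2 * s.den) (2 * s.num.toNat) with hL
  set e := s.den / s.num.toNat + 1 with he
  have hle : ∀ l ∈ L, l ≤ m ∧ l ≤ e ∧ e ≤ l + 1 := fun l hl => by
    have h3 := slope_ceilDiffs_bounds hl
    refine ⟨(short_bounds h1 h2 hl).2, ?_, ?_⟩
    · by_contra h4
      have h5 := Nat.mul_le_mul_right s.num.toNat (show e + 1 ≤ l by omega)
      have h6 : s.den < s.num.toNat * e := Nat.lt_mul_div_succ _ hq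
      rw [add_one_mul] at h5
      rw [mul_comm] at h6
      omega
    · have := (Nat.div_lt_iff_lt_mul hq).2 (by rw [add_one_mul]; exact h3.2 : s.den < (l + 1) * _)
      omega
  let N : ℕ → ℝ → Matrix (Fin 2) (Fin 2) ℝ := fun l x =>
    !![√(hypSq m φ x) * x ^ (m + 1 - l), x ^ (e + 1 - l);
      -(x ^ (l + 1 - e) * (1 + √(hypSq m φ x) ^ 2 * x ^ (2 * m))),
      -(√(hypSq m φ x) * x ^ (m + l + 1))]
  have hy := converges_sqrt_hypSq (φ := φ) hm
  have hN : ∀ l, ∃ M, Tendsto (N l) (𝓝[>] 0) (𝓝 M) := fun l => by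
    obtain ⟨a, ha⟩ := hy.mul (converges_pow (m + 1 - l))
    obtain ⟨b, hb⟩ := converges_pow (e + 1 - l)
    obtain ⟨c, hc⟩ := ((converges_pow (l + 1 - e)).mul
      ((Converges.const 1).add ((hy.pow 2).mul (converges_pow (2 * m))))).neg
    obtain ⟨d, hd⟩ := (hy.mul (converges_pow (m + l + 1))).neg
    exact ⟨_, tendsto_matrix_fin_two ha hb hc hd⟩
  choose M hM using hN
  have h3 : Tendsto (fun x => (L.map fun l => N l x).prod) (𝓝[>] 0) (𝓝 (L.map M).prod) :=
    tendsto_list_prod L fun l _ => hM l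
  have h4 : Continuous fun N : Matrix (Fin 2) (Fin 2) ℝ => |N.trace| :=
    (continuous_id.matrix_trace).abs
  refine ⟨_, ((h4.tendsto _).comp h3).congr' ?_⟩
  filter_upwards [hF] with x hx
  have hx0 := hx.pos
  have h5 : (L.map fun l => (A x ^ l * Q x).val).prod.trace =
      (L.map fun _ => x⁻¹).prod * (L.map fun l => N l x).prod.trace := by
    refine trace_prod_map_eq (T := !![x ^ e, 0; 0, x ^ m]) ?_ fun l hl => ?_
    · rw [Matrix.det_fin_two_of, mul_zero, sub_zero]
      exact (mul_pos (pow_pos hx0 _) (pow_pos hx0 _)).ne'.isUnit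
    · obtain ⟨a1, a2, a3⟩ := hle l hl
      obtain ⟨i, hi⟩ := Nat.exists_eq_add_of_le a1
      rw [pow_mul_val_of_hyperbolic hx.A_val hx.Q_val, Matrix.mul_fin_two]
      simp only [N]
      have e1 : m + 1 - l = i + 1 := by omega
      rw [Matrix.mul_fin_two, e1]
      rcases (by omega : e = l ∨ e = l + 1) with h | h
      · rw [h, show l + 1 - l = 1 by omega, hi]
        ext i j
        fin_cases i <;> fin_cases j <;> simp <;> field_simp <;> ring
      · rw [h, show l + 1 + 1 - l = 2 by omega, Nat.sub_self, hi]
        ext i j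
        fin_cases i <;> fin_cases j <;> simp <;> field_simp <;> ring
  have hpos : 0 < x⁻¹ ^ (2 * s.num.toNat) := by positivity
  rw [Function.comp_apply, slopeTrace_eq_ceilDiffs _ _ hq, absTrace, val_prod_map, h5, abs_mul,
    List.map_const', List.prod_replicate, length_ceilDiffs, abs_of_pos hpos,
    mul_div_cancel_left₀ _ hpos.ne']

lemma tendsto_matrix_of_fin_two {X : Type*} {l : Filter X} {a b c d : X → ℝ} {a₀ b₀ c₀ d₀ : ℝ}
    (ha : Tendsto a l (𝓝 a₀)) (hb : Tendsto b l (𝓝 b₀)) (hc : Tendsto c l (𝓝 c₀))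
    (hd : Tendsto d l (𝓝 d₀)) :
    Tendsto (fun x => !![a x, b x; c x, d x]) l (𝓝 !![a₀, b₀; c₀, d₀]) :=
  tendsto_matrix_fin_two ha hb hc hd

lemma hypOrderLE_near (hm : 2 ≤ m) (hφ : sin φ ≠ 0) (hφn : sin ((2 * n : ℕ) * φ) = 0) {s : ℚ}
    {ks : List ℕ} (hs : IsNear m n s ks) : HypOrderLE m φ s ks.length := by
  intro A Q hF
  have hy := tendsto_hypSq (φ := φ) hm |>.sqrt
  rw [sqrt_one] at hy
  have hp : ∀ k : ℕ, k ≠ 0 → Tendsto (fun x : ℝ => x ^ k) (𝓝[>] 0) (𝓝 0) := fun k hk => by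
    have := ((continuous_pow k).tendsto (0 : ℝ)).mono_left (nhdsWithin_le_nhds (s := Set.Ioi 0))
    rwa [zero_pow hk] at this
  have hw := ((hy.pow 2).mul (hp (2 * m) (by omega))).const_add 1
  have hP : Tendsto (fun x => x • (A x ^ m * Q x).val) (𝓝[>] 0)
      (𝓝 !![1 * 0, 0; -(0 * (1 + 1 ^ 2 * 0)), -(1 * 0)]) := by
    have := tendsto_matrix_of_fin_two (hy.mul (hp 1 (by omega))) (hp 1 (by omega))
      ((hp 1 (by omega)).mul hw).neg
      (hy.mul (hp (2 * m + 1) (by omega))).neg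
    refine this.congr' ?_
    filter_upwards [hF] with x hx
    have hx0 := hx.pos
    rw [pow_mul_val_of_hyperbolic hx.A_val hx.Q_val]
    ext i j
    fin_cases i <;> fin_cases j <;> simp [hx0.ne'] <;> field_simp <;> ring
  have hR : Tendsto (fun x => x • (A x ^ (m + 1) * Q x).val) (𝓝[>] 0)
      (𝓝 !![1, 1; -(0 * (1 + 1 ^ 2 * 0)), -(1 * 0)]) := by
    have := tendsto_matrix_of_fin_two hy (tendsto_const_nhds (x := (1 : ℝ)))
      ((hp 2 (by omega)).mul hw).neg
      (hy.mul (hp (2 * m + 2) (by omega))).neg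
    refine this.congr' ?_
    filter_upwards [hF] with x hx
    have hx0 := hx.pos
    rw [pow_mul_val_of_hyperbolic hx.A_val hx.Q_val]
    ext i j
    fin_cases i <;> fin_cases j <;> simp <;> field_simp <;> ring
  have h3 : Continuous fun M : Matrix (Fin 2) (Fin 2) ℝ => M.adjugate :=
    continuous_id.matrix_adjugate
  have hblock : ∀ k ∈ ks, Tendsto (fun x => (x⁻¹)⁻¹ • ((A x ^ m * Q x * (A x ^ (m + 1) * Q x)) ^ k *
      (A x ^ m * Q x)).val) (𝓝[>] 0) (𝓝 _) := fun k _ => by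
    refine ((hP.const_smul (cheb φ (k + 1))).sub
      (((h3.tendsto _).comp hR).const_smul (cheb φ k))).congr' ?_
    filter_upwards [hF] with x hx
    rw [pow_mul_val_eq hx.isRep hφ, inv_inv]
    simp only [Function.comp_apply, Matrix.adjugate_fin_two]
    ext i j
    fin_cases i <;> fin_cases j <;> simp <;> ring
  refine ⟨_, (tendsto_absTrace_prod (tendsto_inv_atTop_nhdsGT.eventually_gt_atTop 0)
    hblock).congr' ?_⟩
  filter_upwards [hF] with x hx
  rw [hs.trace φ _ _ hx.isRep hφ hφn]

end Hyperbolic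

section Long

open Filter Topology Real

variable {m n : ℕ} {φ : ℝ} {s s' : ℚ}

lemma exists_lead {θ₀ : ℝ} (h0 : 0 ≤ s) : ∃ x, Lead m φ θ₀ s (2 * s.num.toNat) x := by
  rcases Nat.eq_zero_or_pos s.num.toNat with hq | hq
  · have hs : s = 0 := by
      have := Rat.num_nonneg.2 h0
      exact Rat.num_eq_zero.1 (by omega)
    rw [hs]
    exact ⟨_, fun _ _ _ _ h => h.tendsto_slopeTrace_zero⟩
  · exact ⟨_, lead_of_num_pos hq⟩

lemma prod_map_pow_eq {R : Type*} [CommMonoid R] (x : R) (f : ℕ → ℕ) (L : List ℕ) :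
    (L.map fun l => x ^ f l).prod = x ^ (L.map f).sum := by
  induction L with
  | nil => simp
  | cons l L ih => simp [ih, pow_add]

lemma sum_map_sub_add {L : List ℕ} (h : ∀ l ∈ L, m ≤ l) :
    (L.map fun l => l - m).sum + m * L.length = L.sum := by
  induction L with
  | nil => simp
  | cons l L ih =>
    have h1 := ih fun j hj => h j (by simp [hj])
    have h2 := h l (by simp)
    simp only [List.map_cons, List.sum_cons, List.length_cons, mul_add_one]
    omega

lemma HyperbolicFamily.exists_long_form (hm : 2 ≤ m) (h0 : 0 ≤ s) {c : ℕ}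
    (hd : s.den = m * s.num.toNat + c) (hc : s.num.toNat < c) {A Q : ℝ → GL (Fin 2) ℝ}
    (h : HyperbolicFamily m φ A Q) : ∃ E : ℝ → ℝ, Converges (𝓝[>] 0) E ∧
      ∀ᶠ x in 𝓝[>] 0, slopeTrace (A x) (Q x) s / x⁻¹ ^ (2 * c) =
        |hypSq m φ x ^ s.num.toNat + x ^ 2 * E x| := by
  rcases Nat.eq_zero_or_pos s.num.toNat with hq | hq
  · have hs : s = 0 := by
      have := Rat.num_nonneg.2 h0
      exact Rat.num_eq_zero.1 (by omega)
    obtain rfl : c = 1 := by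
      rw [hq, mul_zero, zero_add] at hd
      rw [← hd, hs, Rat.den_zero]
    refine ⟨_, converges_pow 2, ?_⟩
    filter_upwards [h] with x hx
    have hx0 := hx.pos
    rw [slopeTrace, hq, hs]
    have : sturm (2 * (0 : ℚ).den) (2 * 0) (A x) (Q x) = A x * A x := by
      simp [sturm]
    rw [this, absTrace, Units.val_mul, hx.A_val, Matrix.mul_fin_two, Matrix.trace_fin_two_of,
      abs_of_pos (by simp; positivity), abs_of_pos (by positivity)]
    simp only [mul_one, inv_pow]
    field_simp
    ring
  · set L := ceilDiffs (2 * s.den) (2 * s.num.toNat) with hL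
    have hlen : L.length = 2 * s.num.toNat := length_ceilDiffs _ _
    have hge : ∀ l ∈ L, m < l := fun l hl => by
      have h3 := (slope_ceilDiffs_bounds hl).2
      by_contra h4
      have := Nat.mul_le_mul_right s.num.toNat (show l ≤ m by omega)
      omega
    have hsum : (L.map fun l => l - m).sum = 2 * c := by
      have h3 := sum_map_sub_add fun l hl => (hge l hl).le
      have h4 : L.sum = 2 * s.den := sum_ceilDiffs _ (by omega)
      rw [hlen, h4, hd, mul_left_comm, mul_add] at h3
      omega
    have hy := converges_sqrt_hypSq (φ := φ) hm
    obtain ⟨E, C, A', B, hE, -, -, hB, hp⟩ := exists_prod_form (converges_pow 2)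
      (α := fun _ x => √(hypSq m φ x)) (c := fun (_ : ℕ) _ => 1)
      (a := fun l x => -(x ^ (2 * (l - m - 1)) * (1 + √(hypSq m φ x) ^ 2 * x ^ (2 * m))))
      (b := fun l x => -(√(hypSq m φ x) * x ^ (2 * (l - m - 1) + 2 * m))) L
      (fun h => by rw [h, List.length_nil] at hlen; omega)
      fun l _ => ⟨hy, Converges.const 1, ((converges_pow _).mul
        ((Converges.const 1).add ((hy.pow 2).mul (converges_pow _)))).neg,
        (hy.mul (converges_pow _)).neg⟩
    refine ⟨fun x => E x + B x, hE.add hB, ?_⟩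
    filter_upwards [h, (tendsto_hypSq (φ := φ) hm).eventually_const_lt one_pos] with x hx hg
    have hx0 := hx.pos
    have h1 : (L.map fun l => (A x ^ l * Q x).val).prod.trace =
        (L.map fun l => x⁻¹ ^ (l - m)).prod * (L.map fun l => !![√(hypSq m φ x), 1;
          x ^ 2 * -(x ^ (2 * (l - m - 1)) * (1 + √(hypSq m φ x) ^ 2 * x ^ (2 * m))),
          x ^ 2 * -(√(hypSq m φ x) * x ^ (2 * (l - m - 1) + 2 * m))]).prod.trace := by
      refine trace_prod_map_eq (T := 1) (by simp) fun l hl => ?_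
      obtain ⟨d, rfl⟩ := Nat.exists_eq_add_of_lt (hge l hl)
      rw [pow_mul_val_of_hyperbolic hx.A_val hx.Q_val, one_mul, mul_one,
        show m + d + 1 - m - 1 = d by omega, show m + d + 1 - m = d + 1 by omega]
      ext i j
      fin_cases i <;> fin_cases j <;> simp <;> field_simp <;> ring
    have hpos : 0 < x⁻¹ ^ (2 * c) := by positivity
    rw [slopeTrace_eq_ceilDiffs _ _ hq, absTrace, val_prod_map, h1, hp, Matrix.trace_fin_two_of,
      abs_mul, prod_map_pow_eq, hsum, abs_of_pos hpos, mul_div_cancel_left₀ _ hpos.ne',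
      List.map_const', List.prod_replicate, hlen, pow_mul, sq_sqrt hg.le]
    congr 1
    ring

lemma HyperbolicFamily.tendsto_long (hm : 2 ≤ m) (h0 : 0 ≤ s) {c : ℕ}
    (hd : s.den = m * s.num.toNat + c) (hc : s.num.toNat < c) {A Q : ℝ → GL (Fin 2) ℝ}
    (h : HyperbolicFamily m φ A Q) :
    Tendsto (fun x => slopeTrace (A x) (Q x) s / x⁻¹ ^ (2 * c)) (𝓝[>] 0) (𝓝 1) := by
  obtain ⟨E, ⟨e, he⟩, hf⟩ := h.exists_long_form hm h0 hd hc
  have h1 := (((tendsto_hypSq (φ := φ) hm).pow s.num.toNat).add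
    ((((continuous_pow 2).tendsto (0 : ℝ)).mono_left nhdsWithin_le_nhds).mul he)).abs
  simp only [one_pow, ne_eq, OfNat.ofNat_ne_zero, not_false_eq_true, zero_pow, zero_mul, add_zero,
    abs_one] at h1
  exact h1.congr' (hf.mono fun x hx => hx.symm)

lemma long_le_of_hypOrderLE (hm : 2 ≤ m) (hn : 2 ≤ n) (h0 : 0 ≤ s) (ht : TraceEq m n s s') {a c : ℕ}
    (hd : s.den = m * s.num.toNat + c) (hc : s.num.toNat < c)
    (hs' : HypOrderLE m (π / (2 * n : ℕ)) s' a) : 2 * c ≤ a := by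
  have hL := admissible_left hm hn
  obtain ⟨A, Q, hF⟩ := exists_hyperbolicFamily (m := m) (by omega) (cos_pi_div_two_mul_pos hn).le
  obtain ⟨y, hy⟩ := hs' A Q hF
  exact order_le tendsto_inv_atTop_nhdsGT (hF.eventuallyEq ht hL.sin_ne hL.sin_eq)
    (hF.tendsto_long hm h0 hd hc) one_ne_zero hy

lemma hypOrderLE_long (hm : 2 ≤ m) (h0 : 0 ≤ s) {c : ℕ} (hd : s.den = m * s.num.toNat + c)
    (hc : s.num.toNat < c) : HypOrderLE m φ s (2 * c) :=
  fun _ _ hF => ⟨1, hF.tendsto_long hm h0 hd hc⟩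

lemma eq_long_long (hm : 2 ≤ m) (hn : 2 ≤ n) (h0 : 0 ≤ s) (h0' : 0 ≤ s') (ht : TraceEq m n s s')
    {c c' : ℕ} (hd : s.den = m * s.num.toNat + c) (hc : s.num.toNat < c)
    (hd' : s'.den = m * s'.num.toNat + c') (hc' : s'.num.toNat < c') : s = s' := by
  have hL := admissible_left hm hn
  have hcc : 2 * c = 2 * c' :=
    le_antisymm (long_le_of_hypOrderLE hm hn h0 ht hd hc (hypOrderLE_long hm h0' hd' hc'))
      (long_le_of_hypOrderLE hm hn h0' ht.symm hd' hc' (hypOrderLE_long hm h0 hd hc))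
  obtain rfl : c = c' := by omega
  obtain ⟨A, Q, hF⟩ := exists_hyperbolicFamily (m := m) (by omega) (cos_pi_div_two_mul_pos hn).le
  obtain ⟨E, ⟨e, he⟩, hf⟩ := hF.exists_long_form hm h0 hd hc
  obtain ⟨E', ⟨e', he'⟩, hf'⟩ := hF.exists_long_form hm h0' hd' hc'
  set φ := π / (2 * n : ℕ) with hφ
  have hx2 : Tendsto (fun x : ℝ => x ^ 2) (𝓝[>] 0) (𝓝 0) := by
    have := ((continuous_pow 2).tendsto (0 : ℝ)).mono_left (nhdsWithin_le_nhds (s := Set.Ioi 0))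
    rwa [zero_pow two_ne_zero] at this
  have hone : ∀ (q : ℕ) {E : ℝ → ℝ} {e : ℝ}, Tendsto E (𝓝[>] 0) (𝓝 e) →
      ∀ᶠ x in 𝓝[>] 0, 0 < hypSq m φ x ^ q + x ^ 2 * E x := fun q E e hE => by
    have := ((tendsto_hypSq (φ := φ) hm).pow q).add (hx2.mul hE)
    rw [one_pow, zero_mul, add_zero] at this
    exact this.eventually_const_lt one_pos
  have hderiv : ∀ q : ℕ, HasDerivAt (fun x => hypSq m φ x ^ q) (q * (2 * cos φ)) 0 := fun q => by
    have := (hasDerivAt_hypSq (φ := φ) hm).pow q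
    exact this.congr_deriv (by rw [hypSq_zero (by omega), one_pow, mul_one])
  have hsl := (hasDerivAt_iff_tendsto_slope.1
    ((hderiv s.num.toNat).sub (hderiv s'.num.toNat))).mono_left
    (nhdsWithin_mono 0 fun x hx => ne_of_gt hx : 𝓝[>] (0 : ℝ) ≤ 𝓝[≠] 0)
  have hx1 : Tendsto (fun x : ℝ => x) (𝓝[>] 0) (𝓝 0) := nhdsWithin_le_nhds
  have key := tendsto_nhds_unique hsl ((hx1.mul (he'.sub he)).congr' ?_)
  · rw [zero_mul, ← sub_mul] at key
    have hcos := cos_pi_div_two_mul_pos hn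
    have h1 : (s.num.toNat : ℝ) = s'.num.toNat :=
      sub_eq_zero.1 ((mul_eq_zero.1 key).resolve_right (by positivity))
    have h2 : s.num.toNat = s'.num.toNat := by exact_mod_cast h1
    exact slope_ext h0 h0' h2 (by rw [hd, hd', h2])
  · filter_upwards [hf, hf', hone _ he, hone _ he', hF.eventuallyEq ht hL.sin_ne hL.sin_eq,
      self_mem_nhdsWithin] with x h1 h2 h3 h4 h5 hx
    have hx : 0 < x := hx
    rw [h5, h2, abs_of_pos h3, abs_of_pos h4] at h1
    simp only [slope_def_field, Pi.sub_apply, hypSq_zero (show m ≠ 0 by omega), one_pow, sub_self,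
      sub_zero]
    rw [eq_div_iff hx.ne']
    linear_combination h1

lemma ne_long_short (hm : 2 ≤ m) (hn : 2 ≤ n) (h0 : 0 ≤ s) (ht : TraceEq m n s s') {c : ℕ}
    (hd : s.den = m * s.num.toNat + c) (hc : s.num.toNat < c)
    (h1 : s'.den < m * s'.num.toNat) (h2 : s'.num.toNat ≤ s'.den) : False := by
  have hL := admissible_left hm hn
  have hc1 := long_le_of_hypOrderLE hm hn h0 ht hd hc (hypOrderLE_short hm h1 h2)
  have hq' : 0 < s'.num.toNat := Nat.pos_of_ne_zero fun h => by simp [h] at h1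
  have hle : 2 * s'.num.toNat ≤ 2 * s.num.toNat := by
    obtain ⟨x, hx⟩ := exists_lead (m := m) (φ := π / (2 * n : ℕ)) (θ₀ := π / (m + 1 : ℕ)) h0
    refine hL.order_le ht.symm (lead_of_num_pos hq') (prod_map_ne_zero fun l hl => ?_) hx
    have := short_bounds h1 h2 hl
    exact abs_sin_mul_ne_zero (by omega) (by omega) (by omega)
  omega

lemma ne_long_near (hm : 2 ≤ m) (hn : 2 ≤ n) (h0 : 0 ≤ s) (ht : TraceEq m n s s') {c : ℕ}
    (hd : s.den = m * s.num.toNat + c) (hc : s.num.toNat < c) {ks : List ℕ}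
    (hs' : IsNear m n s' ks) : False := by
  have hL := admissible_left hm hn
  have hc1 := long_le_of_hypOrderLE hm hn h0 ht hd hc (hypOrderLE_near hm hL.sin_ne hL.sin_eq hs')
  obtain ⟨x, hx⟩ := exists_lead (m := m) (φ := π / (2 * n : ℕ)) (θ₀ := π / (m + 1 : ℕ)) h0
  obtain ⟨y, hy⟩ := exists_lead (m := m) (φ := π / (2 * n : ℕ)) (θ₀ := π / m) h0
  have := near_length_le hm hn ht.symm hs' hx hy
  omega

end Long

/-- Lemma 3.6: if `r = [m,2]` with `m ≥ 2`, then there are no distinct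
`s, s' ∈ I₁(r;n) ∪ I₂(r;n)` with `u_s` conjugate in `Heck(r;n)` to
`u_{s'}^{±1}`. -/
theorem statement11
    (M : List ℕ) (m n : ℕ) (r : ℚ)
    (hMlen : 2 ≤ M.length) (hMpos : ∀ x ∈ M, 0 < x) (hMlast : 2 ≤ M.getLast!)
    (hm : M.head? = some m) (hn : 2 ≤ n) (hr : r = cfQ M)
    (hm2 : 2 ≤ m) (hM : M = [m, 2]) :
    ¬ ∃ s s' : ℚ, s ≠ s' ∧
      (memI1 M n s ∨ memI2 M n s) ∧ (memI1 M n s' ∨ memI2 M n s') ∧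
      (IsConj (heckQ r n (uWord s)) (heckQ r n (uWord s')) ∨
        IsConj (heckQ r n (uWord s)) ((heckQ r n (uWord s'))⁻¹)) := by
  subst hM hr
  rintro ⟨s, s', hne, hs, hs', hc⟩
  obtain ⟨h0, h⟩ := slope_cases hm2 hn hs
  obtain ⟨h0', h'⟩ := slope_cases hm2 hn hs'
  have ht : TraceEq m n s s' := fun φ A Q hr hφ hsin =>
    slopeTrace_eq hm2 (by omega) hφ hsin h0 h0' hc hr
  rcases h with ⟨c, hd, hlt⟩ | ⟨ks, hk⟩ | ⟨h1, h2⟩ <;>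
    rcases h' with ⟨c', hd', hlt'⟩ | ⟨ks', hk'⟩ | ⟨h1', h2'⟩
  · exact hne (eq_long_long hm2 hn h0 h0' ht hd hlt hd' hlt')
  · exact ne_long_near hm2 hn h0 ht hd hlt hk'
  · exact ne_long_short hm2 hn h0 ht hd hlt h1' h2'
  · exact ne_long_near hm2 hn h0' ht.symm hd' hlt' hk
  · exact hne (eq_near_near hm2 hn h0 h0' ht hk hk')
  · exact ne_short_near hm2 hn ht.symm h1' h2' hk
  · exact ne_long_short hm2 hn h0' ht.symm hd' hlt' h1 h2
  · exact ne_short_near hm2 hn ht h1 h2 hk'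
  · exact hne (eq_short_short hm2 hn h0 h0' ht h1 h2 h1' h2')

end Heckoid
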